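/- There exists an absolute constant C such that for all p ∈ (0,1) and all integers n ≥ 16, E_p(Tam_n) ≥ ζ_p^− · n · exp(−p^8 · exp(C/p²) · (log log n)^4). -/

import Mathlib

open scoped Classical ENNReal

noncomputable section

namespace Ungarian

variable {L : Type*} [Fintype L]

/-- `y` is covered by `x` with respect to the order relation `le`. -/
def CovRel (le : L → L → Prop) (x y : L) : Prop :=
  le y x ∧ y ≠ x ∧ ∀ z, le y z → le z x → z = y ∨ z = x

/-- The finset of elements covered by `x`. -/
def covFinset (le : L → L → Prop) (x : L) : Finset L :=
  Finset.univ.filter fun y => CovRel le x y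

/-- `m` is a greatest lower bound of `S` with respect to `le`. -/
def IsMeetOf (le : L → L → Prop) (S : Set L) (m : L) : Prop :=
  (∀ s ∈ S, le m s) ∧ ∀ z, (∀ s ∈ S, le z s) → le z m

/-- The meet of `{x} ∪ T`. -/
def meetOf (le : L → L → Prop) (x : L) (T : Finset L) : L :=
  if h : ∃ m, IsMeetOf le (insert x (T : Set L)) m then h.choose else x

/-- One-step transition probabilities of the Ungarian Markov chain with parameter `p`:
from `x`, a random subset `T` of the set of elements covered by `x` is chosen, each element
independently with probability `p`, and the chain moves to the meet of `{x} ∪ T`. -/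
def stepProb (p : ℝ) (le : L → L → Prop) (x y : L) : ℝ≥0∞ :=
  ∑ T ∈ (covFinset le x).powerset,
    if meetOf le x T = y then
      ENNReal.ofReal (p ^ T.card * (1 - p) ^ ((covFinset le x).card - T.card))
    else 0

/-- Distribution after `t` steps started from `x`. -/
def walk (p : ℝ) (le : L → L → Prop) (x : L) : ℕ → L → ℝ≥0∞
  | 0 => fun y => if y = x then 1 else 0
  | t + 1 => fun y => ∑ z : L, walk p le x t z * stepProb p le z y

/-- Probability that the chain started at `x` lies in `S` after `t` steps. -/
def probIn (p : ℝ) (le : L → L → Prop) (x : L) (t : ℕ) (S : Set L) : ℝ≥0∞ :=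
  ∑ y ∈ Finset.univ.filter (· ∈ S), walk p le x t y

/-- Expected number of steps until absorption at `bot`, computed as `∑_t P(X_t ≠ bot)`. -/
def expAbsorb (p : ℝ) (le : L → L → Prop) (x bot : L) : ℝ≥0∞ :=
  ∑' t : ℕ, probIn p le x t {y | y ≠ bot}

end Ungarian

/-- `τ` is covered by `σ` in the right weak order on `S_n`:
`τ = σ ∘ (i i+1)` for a descent `i` of `σ`. -/
def wCov {n : ℕ} (σ τ : Equiv.Perm (Fin n)) : Prop :=
  ∃ i : ℕ, ∃ h : i + 1 < n,
    σ ⟨i + 1, h⟩ < σ ⟨i, Nat.lt_of_succ_lt h⟩ ∧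
    τ = σ * Equiv.swap ⟨i, Nat.lt_of_succ_lt h⟩ ⟨i + 1, h⟩

/-- The right weak order on `S_n`: reflexive-transitive closure of the covering relations. -/
def weakLe {n : ℕ} (τ σ : Equiv.Perm (Fin n)) : Prop :=
  Relation.ReflTransGen (fun a b => wCov a b) σ τ

/-- A permutation is `312`-avoiding if no three positions realize the pattern `312`. -/
def Av312 {n : ℕ} (σ : Equiv.Perm (Fin n)) : Prop :=
  ¬ ∃ i1 i2 i3 : Fin n, i1 < i2 ∧ i2 < i3 ∧ σ i3 < σ i1 ∧ σ i2 < σ i3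

/-- The `n`-th Tamari lattice, realized as the sublattice of `312`-avoiding permutations of
the weak order on `S_n`. -/
def TamL (n : ℕ) : Type := {σ : Equiv.Perm (Fin n) // Av312 σ}

noncomputable instance (n : ℕ) : Fintype (TamL n) :=
  @Subtype.fintype _ _ (Classical.decPred _) _

/-- The order on the Tamari lattice, inherited from the weak order on `S_n`. -/
def tamLe {n : ℕ} (a b : TamL n) : Prop := weakLe a.1 b.1

/-- The decreasing permutation is `312`-avoiding; it is the maximal element of `Tam_n`. -/
def tamTop (n : ℕ) : TamL n :=
  ⟨Fin.revPerm, by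
    rintro ⟨i1, i2, i3, h12, h23, _, h32⟩
    simp only [Fin.revPerm_apply, Fin.rev_lt_rev] at h32
    exact absurd h23 (not_lt.2 h32.le)⟩

/-- The identity permutation is `312`-avoiding; it is the minimal element of `Tam_n`. -/
def tamBot (n : ℕ) : TamL n :=
  ⟨1, by
    rintro ⟨i1, i2, i3, h12, h23, h31, _⟩
    simp only [Equiv.Perm.coe_one, id_eq] at h31
    exact absurd h31 (not_lt.2 (h12.trans h23).le)⟩

/-- `E_p(Tam_n)`: expected number of steps for the Ungarian Markov chain on the Tamari lattice
to go from the maximal element to the minimal element. -/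
def EpTam (p : ℝ) (n : ℕ) : ℝ :=
  (Ungarian.expAbsorb p (fun a b : TamL n => tamLe a b) (tamTop n) (tamBot n)).toReal

/-- `ζ_p(n)`: the probability that the maximum of `n` independent geometric random variables
with parameter `p` is attained uniquely. -/
def zeta (p : ℝ) (n : ℕ) : ℝ :=
  ∑' g : Fin n → ℕ,
    if ∃ i, ∀ j, j ≠ i → g j < g i then
      ∏ i, (if 1 ≤ g i then (1 - p) ^ (g i - 1) * p else 0)
    else 0

/-- `ζ_p^- = liminf_n ζ_p(n)`. -/
def zetaMinus (p : ℝ) : ℝ := Filter.liminf (fun n : ℕ => zeta p n) Filter.atTop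

/-! ### The chain on bracket vectors -/

/-- `L` is a (reversed) bracket vector. -/
def BrValid (L : ℕ → ℕ) : Prop :=
  (∀ x, L x ≤ x) ∧ ∀ x y, L x ≤ y → y ≤ x → L x ≤ L y

/-- The largest `c < x` with `L c = L x`. -/
def brPrev (L : ℕ → ℕ) (x : ℕ) : ℕ := Nat.findGreatest (fun c => c < x ∧ L c = L x) x

/-- One step of the chain on bracket vectors with set of active indices `A`. -/
def brStep (A : ℕ → Bool) (L : ℕ → ℕ) (x : ℕ) : ℕ :=
  if A x = true ∧ L x < x then brPrev L x + 1 else L x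

/-- The chain on bracket vectors driven by the activations `act time index`. -/
def brRun (act : ℕ → ℕ → Bool) : ℕ → ℕ → ℕ
  | 0 => fun _ => 0
  | t + 1 => brStep (act t) (brRun act t)

/-- Number of activations of `c` in the time interval `[s, t)`. -/
def actCount (act : ℕ → ℕ → Bool) (c s t : ℕ) : ℕ :=
  ((Finset.Ico s t).filter fun r => act r c = true).card

theorem BrValid.apply_self {L : ℕ → ℕ} (h : BrValid L) {x : ℕ} : L (L x) = L x :=
  le_antisymm (h.1 _) (h.2 x (L x) le_rfl (h.1 x))

theorem brPrev_spec {L : ℕ → ℕ} (h : BrValid L) {x : ℕ} (hx : L x < x) :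
    brPrev L x < x ∧ L (brPrev L x) = L x :=
  Nat.findGreatest_spec (P := fun c => c < x ∧ L c = L x) (m := L x) hx.le ⟨hx, h.apply_self⟩

theorem le_brPrev {L : ℕ → ℕ} {x c : ℕ} (hc : c < x) (he : L c = L x) : c ≤ brPrev L x :=
  Nat.le_findGreatest (P := fun c => c < x ∧ L c = L x) hc.le ⟨hc, he⟩

theorem self_le_brPrev {L : ℕ → ℕ} (h : BrValid L) {x : ℕ} (hx : L x < x) : L x ≤ brPrev L x :=
  le_brPrev hx h.apply_self

theorem brPrev_congr {L L' : ℕ → ℕ} {x : ℕ} (h : ∀ c ≤ x, L c = L' c) :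
    brPrev L x = brPrev L' x := by
  unfold brPrev
  apply le_antisymm
  · refine Nat.findGreatest_mono_left (fun c hc => ?_) x |>.trans_eq rfl
    exact ⟨hc.1, by rw [← h c hc.1.le, ← h x le_rfl]; exact hc.2⟩
  · refine Nat.findGreatest_mono_left (fun c hc => ?_) x |>.trans_eq rfl
    exact ⟨hc.1, by rw [h c hc.1.le, h x le_rfl]; exact hc.2⟩

theorem brStep_congr {A A' : ℕ → Bool} {L L' : ℕ → ℕ} {x : ℕ} (h : ∀ c ≤ x, L c = L' c)
    (hA : A x = A' x) : brStep A L x = brStep A' L' x := by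
  simp only [brStep, hA, h x le_rfl, brPrev_congr h]

theorem le_brStep {L : ℕ → ℕ} (h : BrValid L) (A : ℕ → Bool) (x : ℕ) : L x ≤ brStep A L x := by
  unfold brStep
  split_ifs with hx
  · exact (self_le_brPrev h hx.2).trans (Nat.le_succ _)
  · exact le_rfl

theorem brStep_valid {L : ℕ → ℕ} (h : BrValid L) (A : ℕ → Bool) : BrValid (brStep A L) := by
  refine ⟨fun x => ?_, fun x y hxy hy => ?_⟩
  · unfold brStep
    split_ifs with hx
    · exact (brPrev_spec h hx.2).1
    · exact h.1 x
  · rcases hy.eq_or_lt with rfl | hy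
    · exact le_rfl
    by_cases hx : A x = true ∧ L x < x
    · rw [brStep, if_pos hx] at hxy ⊢
      obtain ⟨h1, h2⟩ := brPrev_spec h hx.2
      have h3 := self_le_brPrev h hx.2
      refine le_trans ?_ (le_brStep h A y)
      have h4 : L x ≤ L y := h.2 x y (by omega) hy.le
      have h5 : L y ≠ L x := fun he => by have := le_brPrev hy he; omega
      by_contra hlt
      have h6 := h.2 y (brPrev L x) (by omega) (by omega)
      omega
    · rw [brStep, if_neg hx] at hxy ⊢
      exact (h.2 x y hxy hy.le).trans (le_brStep h A y)

theorem brRun_valid (act : ℕ → ℕ → Bool) (t : ℕ) : BrValid (brRun act t) := by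
  induction t with
  | zero => exact ⟨fun _ => Nat.zero_le _, fun _ _ _ _ => le_rfl⟩
  | succ t ih => exact brStep_valid ih _

theorem brRun_congr {act act' : ℕ → ℕ → Bool} {t c : ℕ}
    (h : ∀ s < t, ∀ d ≤ c, act s d = act' s d) : brRun act t c = brRun act' t c := by
  induction t generalizing c with
  | zero => rfl
  | succ t ih =>
    refine brStep_congr (fun d hd => ih fun s hs d' hd' => ?_) (h t (Nat.lt_succ_self _) c le_rfl)
    exact h s (hs.trans (Nat.lt_succ_self _)) d' (hd'.trans hd)

theorem brRun_mono (act : ℕ → ℕ → Bool) (c : ℕ) : Monotone fun t => brRun act t c :=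
  monotone_nat_of_le_succ fun t => le_brStep (brRun_valid act t) _ c

theorem actCount_succ (act : ℕ → ℕ → Bool) (c : ℕ) {s t : ℕ} (h : s ≤ t) :
    actCount act c s (t + 1) = actCount act c s t + if act t c = true then 1 else 0 := by
  unfold actCount
  rw [← Finset.insert_Ico_right_eq_Ico_add_one h, Finset.filter_insert]
  split_ifs <;> simp

theorem actCount_self (act : ℕ → ℕ → Bool) (c s : ℕ) : actCount act c s s = 0 := by
  simp [actCount]

theorem actCount_le (act : ℕ → ℕ → Bool) (c s t : ℕ) : actCount act c s t ≤ t - s := by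
  unfold actCount
  exact (Finset.card_filter_le _ _).trans_eq (Nat.card_Ico _ _)

/-- Every activation moves an unsettled index by at least one. -/
theorem min_le_brRun (act : ℕ → ℕ → Bool) (c : ℕ) {s t : ℕ} (h : s ≤ t) :
    min c (brRun act s c + actCount act c s t) ≤ brRun act t c := by
  induction t, h using Nat.le_induction with
  | base => simp [actCount_self]
  | succ t h ih =>
    rw [actCount_succ act c h]
    have h1 := le_brStep (brRun_valid act t) (act t) c
    by_cases ha : act t c = true
    · by_cases hc : brRun act t c < c
      · have h2 : brRun act (t + 1) c = brPrev (brRun act t) c + 1 := by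
          simp [brRun, brStep, ha, hc]
        have h3 := self_le_brPrev (brRun_valid act t) hc
        simp only [ha, if_true]
        omega
      · have : brRun act t c ≤ brRun act (t + 1) c := h1
        omega
    · have : brRun act t c ≤ brRun act (t + 1) c := h1
      simp only [ha]
      simp only [Bool.false_eq_true, if_false]
      omega

theorem brRun_eq_zero {act : ℕ → ℕ → Bool} {c t : ℕ} (h : ∀ s < t, act s c = false) :
    brRun act t c = 0 := by
  induction t with
  | zero => rfl
  | succ t ih =>
    have h1 : act t c = false := h t (Nat.lt_succ_self _)
    have h2 := ih fun s hs => h s (hs.trans (Nat.lt_succ_self _))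
    simp [brRun, brStep, h1, h2]

/-- Index `z` is activated for the first time strictly after all `z' ∈ (y, z)`. -/
def StrictRec (act : ℕ → ℕ → Bool) (y z : ℕ) : Prop :=
  ∀ z', y < z' → z' < z → ∃ s, act s z' = true ∧ ∀ r ≤ s, act r z = false

theorem strictRec_of_brRun_le {act : ℕ → ℕ → Bool} {e t y z : ℕ} (hz : ∃ s < e, act s z = true)
    (het : e ≤ t) (h : brRun act t z ≤ y) : StrictRec act y z := by
  intro z' hy hz'
  by_contra hcon
  push Not at hcon
  have hex : ∃ s, act s z = true := hz.imp fun s hs => hs.2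
  set s0 := Nat.find hex
  have hs0 : act s0 z = true := Nat.find_spec hex
  have hmin : ∀ r < s0, act r z = false := fun r hr => by simpa using Nat.find_min hex hr
  have hs0e : s0 < e := by
    obtain ⟨s, hs, hsz⟩ := hz
    exact (Nat.find_min' hex hsz).trans_lt hs
  have h1 : brRun act s0 z = 0 := brRun_eq_zero hmin
  have h2 : brRun act s0 z' = 0 := brRun_eq_zero fun s hs => by
    by_contra hne
    obtain ⟨r, hr, hr'⟩ := hcon s (by simpa using hne)
    exact hr' (hmin r (hr.trans_lt hs))
  have h3 : brRun act (s0 + 1) z = brPrev (brRun act s0) z + 1 := by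
    have : brRun act s0 z < z := by omega
    simp [brRun, brStep, hs0, this]
  have h4 : z' ≤ brPrev (brRun act s0) z := le_brPrev hz' (by rw [h1, h2])
  have h5 : brRun act (s0 + 1) z ≤ brRun act t z := brRun_mono act z (by omega)
  omega

theorem card_strictRec_le {act : ℕ → ℕ → Bool} {e y : ℕ} (S : Finset ℕ)
    (hS : ∀ z ∈ S, y < z ∧ (∃ s < e, act s z = true) ∧ StrictRec act y z) : S.card ≤ e := by
  classical
  have hex : ∀ z ∈ S, ∃ s, act s z = true := fun z hz => (hS z hz).2.1.imp fun s hs => hs.2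
  let f : ℕ → ℕ := fun z => sInf {s | act s z = true}
  have hf1 : ∀ z ∈ S, act (f z) z = true := fun z hz => Nat.sInf_mem (hex z hz)
  have hf2 : ∀ z s, act s z = true → f z ≤ s := fun z s hs => Nat.sInf_le hs
  have hlt : ∀ z ∈ S, ∀ z' ∈ S, z' < z → f z' < f z := by
    intro z hz z' hz' h
    obtain ⟨s, hs, hr⟩ := (hS z hz).2.2 z' (hS z' hz').1 h
    by_contra hcon
    have h1 := hf2 z' s hs
    have h2 := hr (f z) (by omega)
    rw [hf1 z hz] at h2
    exact absurd h2 (by simp)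
  calc S.card ≤ (Finset.range e).card := by
        refine Finset.card_le_card_of_injOn f (fun z hz => ?_) (fun z hz z' hz' hzz => ?_)
        · obtain ⟨s, hs, hsz⟩ := (hS z hz).2.1
          simpa using (hf2 z s hsz).trans_lt hs
        · rcases lt_trichotomy z z' with h | h | h
          · have := hlt z' hz' z hz h; omega
          · exact h
          · have := hlt z hz z' hz' h; omega
    _ = e := Finset.card_range e

/-- The sequence of barriers behind which index `x` is left alone. -/
def barrier (act : ℕ → ℕ → Bool) (x e : ℕ) (a : ℕ → ℕ) : ℕ → ℕ
  | 0 => 0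
  | i + 1 => Nat.findGreatest (fun z => z = barrier act x e a i + a (i + 1) ∨ z < x ∧
      brRun act (e + a (i + 1) / 2) z ≤ barrier act x e a i + a (i + 1))
        (barrier act x e a i + a (i + 1) + x)

/-- Index `c` may interact with `x` during the `i`-th stage. -/
def Relevant (act : ℕ → ℕ → Bool) (x e : ℕ) (a : ℕ → ℕ) (i c : ℕ) : Prop :=
  barrier act x e a i < c ∧ c < x ∧
    brRun act (e + a i / 2) c ≤ barrier act x e a i + a (i + 1)

theorem le_barrier_succ (act : ℕ → ℕ → Bool) (x e : ℕ) (a : ℕ → ℕ) (i : ℕ) :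
    barrier act x e a i + a (i + 1) ≤ barrier act x e a (i + 1) := by
  rw [barrier]
  exact Nat.le_findGreatest (Nat.le_add_right _ _) (Or.inl rfl)

theorem barrier_succ_spec (act : ℕ → ℕ → Bool) (x e : ℕ) (a : ℕ → ℕ) (i : ℕ) :
    barrier act x e a (i + 1) = barrier act x e a i + a (i + 1) ∨
      barrier act x e a (i + 1) < x ∧
        brRun act (e + a (i + 1) / 2) (barrier act x e a (i + 1)) ≤
          barrier act x e a i + a (i + 1) := by
  have := Nat.findGreatest_spec (P := fun z => z = barrier act x e a i + a (i + 1) ∨ z < x ∧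
      brRun act (e + a (i + 1) / 2) z ≤ barrier act x e a i + a (i + 1))
      (m := barrier act x e a i + a (i + 1)) (Nat.le_add_right _ x) (Or.inl rfl)
  rwa [← barrier] at this

theorem lt_brRun_of_barrier_lt (act : ℕ → ℕ → Bool) (x e : ℕ) (a : ℕ → ℕ) (i z : ℕ)
    (hz : barrier act x e a (i + 1) < z) (hzx : z < x) :
    barrier act x e a (i + 1) < brRun act (e + a (i + 1) / 2) z := by
  set b := barrier act x e a i + a (i + 1) with hb
  have h1 : b < brRun act (e + a (i + 1) / 2) z := by
    by_contra hcon
    have : z ≤ barrier act x e a (i + 1) := by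
      rw [barrier]
      exact Nat.le_findGreatest (by omega) (Or.inr ⟨hzx, by omega⟩)
    omega
  rcases barrier_succ_spec act x e a i with h | ⟨_, h⟩
  · omega
  · by_contra hcon
    have := (brRun_valid act (e + a (i + 1) / 2)).2 z (barrier act x e a (i + 1))
      (by omega) hz.le
    omega

/-- Deterministic core: if `x` starts late, no relevant index is ever caught up by `x`, and there
is always enough room, then `x` is unsettled at the end of the last stage. -/
theorem brRun_lt_of_stages {act : ℕ → ℕ → Bool} {x e k ρ : ℕ} {a R : ℕ → ℕ}
    (ha : Monotone a) (haρ : ∀ i, a i ≤ ρ)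
    (hx : ∀ s < e + a 0, act s x = false)
    (hoth : ∀ c, 0 < c → c < x → ∃ s < e, act s c = true)
    (hR0 : R 0 ≤ x) (hRρ : ∀ i ≤ k, ρ < R i)
    (hroom : ∀ i < k, ∀ z, x - R (i + 1) < z → z < x → ¬ StrictRec act (x - R i + ρ) z)
    (hrace : ∀ i < k + 1, ∀ c, Relevant act x e a i c → ∀ t, e + a i ≤ t → t < e + a (i + 1) →
      actCount act x (e + a i) t ≤ actCount act c (e + a i / 2) t)
    (hRmono : ∀ i < k, R (i + 1) + ρ ≤ R i) :
    brRun act (e + a (k + 1)) x < x := by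
  have hRx : ∀ i ≤ k, R i ≤ x := by
    intro i
    induction i with
    | zero => exact fun _ => hR0
    | succ i ih => intro hi; have := hRmono i hi; have := ih (by omega); omega
  have stage : ∀ i ≤ k, (∀ z, barrier act x e a i < z → z < x →
      barrier act x e a i < brRun act (e + a i / 2) z) →
      brRun act (e + a i) x ≤ barrier act x e a i →
      brRun act (e + a (i + 1)) x ≤ barrier act x e a i + a (i + 1) := by
    intro i hi h1 h2
    set b := barrier act x e a i with hb
    have key : ∀ t, e + a i ≤ t → t ≤ e + a (i + 1) →
        brRun act t x ≤ b + actCount act x (e + a i) t := by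
      intro t ht
      induction t, ht using Nat.le_induction with
      | base => intro _; simpa [actCount_self] using h2
      | succ t ht ih =>
        intro ht'
        have ih := ih (by omega)
        have hv := brRun_valid act t
        rw [actCount_succ act x ht]
        by_cases hact : act t x = true ∧ brRun act t x < x
        · have hstep : brRun act (t + 1) x = brPrev (brRun act t) x + 1 := by
            simp [brRun, brStep, hact]
          rw [hstep, if_pos hact.1]
          obtain ⟨hc1, hc2⟩ := brPrev_spec hv hact.2
          have hc3 := self_le_brPrev hv hact.2
          set c := brPrev (brRun act t) x
          by_contra hcon
          have hbc : b < c := by omega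
          have h3 : b < brRun act (e + a i / 2) c := h1 c hbc hc1
          have h4 : brRun act (e + a i / 2) c ≤ brRun act t c := brRun_mono act c (by omega)
          have h5 := actCount_le act x (e + a i) t
          have h6 := hrace i (by omega) c ⟨hbc, hc1, by omega⟩ t ht (by omega)
          have h7 := min_le_brRun act c (s := e + a i / 2) (t := t) (by omega)
          omega
        · have hstep : brRun act (t + 1) x = brRun act t x := by
            simp only [brRun, brStep, if_neg hact]
          omega
    have h3 := key (e + a (i + 1)) (by have := ha (Nat.le_add_right i 1); omega) le_rfl
    have h4 := actCount_le act x (e + a i) (e + a (i + 1))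
    omega
  have main : ∀ i ≤ k, (∀ z, barrier act x e a i < z → z < x →
      barrier act x e a i < brRun act (e + a i / 2) z) ∧
      brRun act (e + a i) x ≤ barrier act x e a i ∧ barrier act x e a i ≤ x - R i := by
    intro i
    induction i with
    | zero =>
      intro _
      refine ⟨fun z hz hzx => ?_, ?_, Nat.zero_le _⟩
      · change 0 < _
        obtain ⟨s, hs, hsz⟩ := hoth z hz hzx
        have h1 := min_le_brRun act z (s := 0) (t := e + a 0 / 2) (Nat.zero_le _)
        have h2 : 0 < actCount act z 0 (e + a 0 / 2) :=
          Finset.card_pos.2 ⟨s, by simp [hsz]; omega⟩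
        have h3 : 0 < z := hz
        omega
      · rw [brRun_eq_zero hx]; exact Nat.zero_le _
    | succ i ih =>
      intro hi
      obtain ⟨h1, h2, h3⟩ := ih (by omega)
      refine ⟨fun z hz hzx => lt_brRun_of_barrier_lt act x e a i z hz hzx,
        (stage i (by omega) h1 h2).trans (le_barrier_succ act x e a i), ?_⟩
      have hRi := hRmono i hi
      have hRxi := hRx i (by omega)
      have haρ' := haρ (i + 1)
      rcases barrier_succ_spec act x e a i with h | ⟨hlt, h⟩
      · omega
      · by_contra hcon
        have hpos : 0 < barrier act x e a (i + 1) := by omega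
        refine hroom i hi (barrier act x e a (i + 1)) (by omega) hlt ?_
        have := strictRec_of_brRun_le (hoth _ hpos hlt) (Nat.le_add_right e _) h
        intro z' hz'
        exact this z' (by omega)
  obtain ⟨h1, h2, h3⟩ := main k le_rfl
  have h4 := stage k le_rfl h1 h2
  have h5 := hRρ k le_rfl
  have h6 := hRx k le_rfl
  have h7 := haρ (k + 1)
  omega

/-! ### Tamari lattices and bracket vectors -/

theorem perm_eq_of_forall_lt {n : ℕ} {σ τ : Equiv.Perm (Fin n)}
    (h : ∀ u v, σ.symm u < σ.symm v → τ.symm u < τ.symm v) : σ = τ := by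
  have hm : StrictMono (σ.trans τ.symm) := fun i j hij => by
    simpa using h (σ i) (σ j) (by simpa using hij)
  have h1 : (hm.orderIsoOfSurjective _ (σ.trans τ.symm).surjective) = OrderIso.refl (Fin n) :=
    Subsingleton.elim _ _
  ext1 i
  have h2 := DFunLike.congr_fun h1 i
  simp only [StrictMono.coe_orderIsoOfSurjective, OrderIso.refl_apply, Equiv.trans_apply] at h2
  exact (Equiv.symm_apply_eq _).1 h2

/-- The inversions of `σ`, as pairs of values. -/
def IsInv {n : ℕ} (σ : Equiv.Perm (Fin n)) (u v : Fin n) : Prop :=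
  u < v ∧ σ.symm v < σ.symm u

theorem swap_lt_swap_adjacent {n i : ℕ} (h : i + 1 < n) {a b : Fin n} (hab : b < a)
    (hs : Equiv.swap (⟨i, Nat.lt_of_succ_lt h⟩ : Fin n) ⟨i + 1, h⟩ a <
      Equiv.swap (⟨i, Nat.lt_of_succ_lt h⟩ : Fin n) ⟨i + 1, h⟩ b) :
    b = ⟨i, Nat.lt_of_succ_lt h⟩ ∧ a = ⟨i + 1, h⟩ := by
  simp only [Equiv.swap_apply_def] at hs
  split_ifs at hs <;> simp only [Fin.ext_iff, Fin.lt_def] at * <;> omega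

theorem IsInv.of_wCov {n : ℕ} {σ τ : Equiv.Perm (Fin n)} (h : wCov σ τ) {u v : Fin n}
    (hτ : IsInv τ u v) : IsInv σ u v := by
  obtain ⟨i, hi, hd, rfl⟩ := h
  refine ⟨hτ.1, ?_⟩
  have h1 : Equiv.swap (⟨i, Nat.lt_of_succ_lt hi⟩ : Fin n) ⟨i + 1, hi⟩ (σ.symm v) <
    Equiv.swap (⟨i, Nat.lt_of_succ_lt hi⟩ : Fin n) ⟨i + 1, hi⟩ (σ.symm u) := hτ.2
  by_contra hcon
  have hne : σ.symm u ≠ σ.symm v := fun he => hτ.1.ne (σ.symm.injective he)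
  obtain ⟨h2, h3⟩ := swap_lt_swap_adjacent hi (lt_of_le_of_ne (not_lt.1 hcon) hne) h1
  rw [Equiv.symm_apply_eq] at h2 h3
  rw [← h2, ← h3] at hd
  exact absurd hτ.1 (not_lt.2 hd.le)

theorem weakLe_of_isInv {n : ℕ} (σ τ : Equiv.Perm (Fin n)) (h : ∀ u v, IsInv τ u v → IsInv σ u v) :
    weakLe τ σ := by
  obtain ⟨N, hN⟩ : ∃ N, (Finset.univ.filter fun w : Fin n × Fin n => IsInv σ w.1 w.2).card = N :=
    ⟨_, rfl⟩
  induction N using Nat.strong_induction_on generalizing σ with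
  | _ N ih =>
    by_cases hex : ∃ i : ℕ, ∃ hi : i + 1 < n,
        σ ⟨i + 1, hi⟩ < σ ⟨i, Nat.lt_of_succ_lt hi⟩ ∧
        ¬ IsInv τ (σ ⟨i + 1, hi⟩) (σ ⟨i, Nat.lt_of_succ_lt hi⟩)
    · obtain ⟨i, hi, hd, hnot⟩ := hex
      set s := Equiv.swap (⟨i, Nat.lt_of_succ_lt hi⟩ : Fin n) ⟨i + 1, hi⟩ with hs
      have hc : wCov σ (σ * s) := ⟨i, hi, hd, rfl⟩
      have hsub : ∀ u v, IsInv τ u v → IsInv (σ * s) u v := by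
        intro u v huv
        refine ⟨huv.1, ?_⟩
        change s (σ.symm v) < s (σ.symm u)
        have h1 := (h u v huv).2
        by_contra hcon
        have hne : s (σ.symm u) ≠ s (σ.symm v) := fun he =>
          huv.1.ne (σ.symm.injective (s.injective he))
        have h2 : s (s (σ.symm v)) < s (s (σ.symm u)) := by simpa [hs] using h1
        obtain ⟨h3, h4⟩ := swap_lt_swap_adjacent hi
          (lt_of_le_of_ne (not_lt.1 hcon) hne) h2
        have h5 : σ.symm u = ⟨i + 1, hi⟩ := by
          simpa [hs] using congrArg s h3
        have h6 : σ.symm v = ⟨i, Nat.lt_of_succ_lt hi⟩ := by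
          simpa [hs] using congrArg s h4
        rw [Equiv.symm_apply_eq] at h5 h6
        exact hnot (by rw [← h5, ← h6]; exact huv)
      refine Relation.ReflTransGen.head hc (ih _ ?_ (σ * s) hsub rfl)
      rw [← hN]
      refine Finset.card_lt_card (Finset.ssubset_iff_of_subset (fun w hw => ?_) |>.2
        ⟨(σ ⟨i + 1, hi⟩, σ ⟨i, Nat.lt_of_succ_lt hi⟩), ?_, ?_⟩)
      · simp only [Finset.mem_filter, Finset.mem_univ, true_and] at hw ⊢
        exact hw.of_wCov hc
      · simp only [Finset.mem_filter, Finset.mem_univ, true_and]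
        exact ⟨hd, by simp [Fin.lt_def]⟩
      · simp only [Finset.mem_filter, Finset.mem_univ, true_and]
        intro hcon
        have : s (σ.symm (σ ⟨i, Nat.lt_of_succ_lt hi⟩)) < s (σ.symm (σ ⟨i + 1, hi⟩)) := hcon.2
        simp [hs, Fin.lt_def] at this
    · push Not at hex
      have heq : σ = τ := by
        refine perm_eq_of_forall_lt ?_
        have key : ∀ d i : ℕ, ∀ hi : i + d + 1 < n,
            τ.symm (σ ⟨i, by omega⟩) < τ.symm (σ ⟨i + d + 1, hi⟩) := by
          have base : ∀ i : ℕ, ∀ hi : i + 1 < n,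
              τ.symm (σ ⟨i, by omega⟩) < τ.symm (σ ⟨i + 1, hi⟩) := by
            intro i hi
            rcases lt_trichotomy (σ ⟨i + 1, hi⟩) (σ ⟨i, Nat.lt_of_succ_lt hi⟩) with h1 | h1 | h1
            · exact (hex i hi h1).2
            · simp [Fin.ext_iff] at h1
            · by_contra hcon
              have hne : τ.symm (σ ⟨i + 1, hi⟩) ≠ τ.symm (σ ⟨i, Nat.lt_of_succ_lt hi⟩) := by simp
              have := (h _ _ ⟨h1, lt_of_le_of_ne (not_lt.1 hcon) hne⟩).2
              simp [Fin.lt_def] at this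
          intro d
          induction d with
          | zero => exact base
          | succ d ihd =>
            intro i hi
            exact (ihd i (by omega)).trans (base (i + d + 1) (by omega))
        intro u v huv
        have := key (σ.symm v - σ.symm u - 1 : ℕ) (σ.symm u) (by
          have := (σ.symm v).2; rw [Fin.lt_def] at huv; omega)
        have h1 : (⟨(σ.symm u : ℕ) + ((σ.symm v : ℕ) - (σ.symm u : ℕ) - 1) + 1, by
          have := (σ.symm v).2; rw [Fin.lt_def] at huv; omega⟩ : Fin n) = σ.symm v := by
            rw [Fin.lt_def] at huv; ext; simp only; omega
        rw [h1] at this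
        simpa using this
      rw [heq]
      exact Relation.ReflTransGen.refl

theorem weakLe_iff {n : ℕ} (σ τ : Equiv.Perm (Fin n)) :
    weakLe τ σ ↔ ∀ u v, IsInv τ u v → IsInv σ u v := by
  refine ⟨fun h => ?_, weakLe_of_isInv σ τ⟩
  unfold weakLe at h
  induction h with
  | refl => exact fun _ _ h => h
  | tail _ hc ih => exact fun u v h => ih u v (h.of_wCov hc)

/-- Position of the value `n - 1 - x` in the permutation `σ`, extended by the identity. -/
def permPos {n : ℕ} (σ : Equiv.Perm (Fin n)) (x : ℕ) : ℕ :=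
  if h : x < n then (σ.symm (Fin.rev ⟨x, h⟩) : ℕ) else x

theorem permPos_lt {n : ℕ} (σ : Equiv.Perm (Fin n)) {x : ℕ} (h : x < n) : permPos σ x < n := by
  simp [permPos, h]

theorem permPos_of_le {n : ℕ} (σ : Equiv.Perm (Fin n)) {x : ℕ} (h : n ≤ x) : permPos σ x = x := by
  simp [permPos, not_lt.2 h]

theorem permPos_injective {n : ℕ} (σ : Equiv.Perm (Fin n)) : Function.Injective (permPos σ) := by
  intro x y h
  by_cases hx : x < n <;> by_cases hy : y < n
  · simpa [permPos, hx, hy, ← Fin.ext_iff] using h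
  · have := permPos_lt σ hx
    rw [permPos_of_le σ (not_lt.1 hy)] at h
    omega
  · have := permPos_lt σ hy
    rw [permPos_of_le σ (not_lt.1 hx)] at h
    omega
  · rwa [permPos_of_le σ (not_lt.1 hx), permPos_of_le σ (not_lt.1 hy)] at h

theorem permPos_rev {n : ℕ} (σ : Equiv.Perm (Fin n)) (u : Fin n) :
    permPos σ (Fin.rev u) = σ.symm u := by
  rw [permPos, dif_pos (Fin.rev u).2]
  simp only [Fin.eta, Fin.rev_rev]

theorem Av312.permPos_lt {n : ℕ} {σ : Equiv.Perm (Fin n)} (h : Av312 σ) {x y z : ℕ}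
    (hxy : x < y) (hyz : y < z) (hp : permPos σ x < permPos σ z) :
    permPos σ y < permPos σ z := by
  by_cases hz : z < n
  · by_contra hcon
    have hne : permPos σ z ≠ permPos σ y := fun he => hyz.ne' (permPos_injective σ he)
    have hlt : permPos σ z < permPos σ y := lt_of_le_of_ne (not_lt.1 hcon) hne
    have hx : x < n := by omega
    have hy : y < n := by omega
    simp only [permPos, hx, hy, hz, dif_pos] at hp hlt
    refine h ⟨_, _, _, Fin.lt_def.2 hp, Fin.lt_def.2 hlt, ?_, ?_⟩ <;>
      simp [Fin.lt_def] <;> omega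
  · rw [permPos_of_le σ (not_lt.1 hz)]
    by_cases hy : y < n
    · have := _root_.permPos_lt σ hy; omega
    · rw [permPos_of_le σ (not_lt.1 hy)]; exact hyz

/-- The bracket vector of an element of the Tamari lattice. -/
def bracket {n : ℕ} (a : TamL n) (x : ℕ) : ℕ := sInf {y | y ≤ x ∧ permPos a.1 y ≤ permPos a.1 x}

theorem bracket_spec {n : ℕ} (a : TamL n) (x : ℕ) :
    bracket a x ≤ x ∧ permPos a.1 (bracket a x) ≤ permPos a.1 x :=
  Nat.sInf_mem (s := {y | y ≤ x ∧ permPos a.1 y ≤ permPos a.1 x}) ⟨x, le_rfl, le_rfl⟩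

theorem bracket_le_iff {n : ℕ} (a : TamL n) {x y : ℕ} (h : y ≤ x) :
    bracket a x ≤ y ↔ permPos a.1 y ≤ permPos a.1 x := by
  refine ⟨fun hl => ?_, fun hp => Nat.sInf_le ⟨h, hp⟩⟩
  obtain ⟨h1, h2⟩ := bracket_spec a x
  rcases hl.eq_or_lt with rfl | hl
  · exact h2
  rcases h.eq_or_lt with rfl | h
  · exact le_rfl
  have hne : permPos a.1 (bracket a x) ≠ permPos a.1 x := fun he => by
    have := permPos_injective _ he; omega
  exact (a.2.permPos_lt hl h (lt_of_le_of_ne h2 hne)).le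

theorem bracket_valid {n : ℕ} (a : TamL n) : BrValid (bracket a) := by
  refine ⟨fun x => (bracket_spec a x).1, fun x y hxy hy => ?_⟩
  obtain ⟨h1, h2⟩ := bracket_spec a y
  rw [bracket_le_iff a (h1.trans hy)]
  exact h2.trans ((bracket_le_iff a hy).1 hxy)

theorem bracket_of_le {n : ℕ} (a : TamL n) {x : ℕ} (h : n ≤ x) : bracket a x = 0 := by
  refine Nat.le_zero.1 ((bracket_le_iff a (Nat.zero_le x)).2 ?_)
  rw [permPos_of_le _ h]
  by_cases hn : 0 < n
  · exact (permPos_lt _ hn).le.trans h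
  · rw [permPos_of_le _ (by omega)]; exact Nat.zero_le _

theorem isInv_iff {n : ℕ} (a : TamL n) (u v : Fin n) :
    IsInv a.1 u v ↔ u < v ∧ bracket a (Fin.rev u) ≤ Fin.rev v := by
  refine and_congr_right fun h => ?_
  have h1 : ((Fin.rev v : Fin n) : ℕ) ≤ (Fin.rev u : Fin n) := by
    have := Fin.rev_lt_rev.2 h; exact this.le
  rw [bracket_le_iff a h1, permPos_rev, permPos_rev, Fin.lt_def]
  refine ⟨le_of_lt, fun h2 => lt_of_le_of_ne h2 fun he => h.ne ?_⟩
  exact (a.1.symm.injective (Fin.ext he)).symm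

theorem tamLe_iff {n : ℕ} (a b : TamL n) : tamLe a b ↔ ∀ x, bracket b x ≤ bracket a x := by
  rw [tamLe, weakLe_iff]
  constructor
  · intro h x
    by_cases hx : x < n
    · obtain ⟨h1, h2⟩ := bracket_spec a x
      rcases h1.eq_or_lt with h1 | h1
      · rw [h1]; exact (bracket_spec b x).1
      have h3 := (isInv_iff a (Fin.rev ⟨x, hx⟩) (Fin.rev ⟨bracket a x, h1.trans hx⟩)).2
        ⟨Fin.rev_lt_rev.2 (Fin.lt_def.2 h1), by simp⟩
      have h4 := ((isInv_iff b _ _).1 (h _ _ h3)).2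
      simpa using h4
    · rw [bracket_of_le b (not_lt.1 hx)]; exact Nat.zero_le _
  · intro h u v huv
    rw [isInv_iff] at huv ⊢
    exact ⟨huv.1, (h _).trans huv.2⟩

theorem bracket_injective {n : ℕ} : Function.Injective (bracket (n := n)) := by
  intro a b h
  refine Subtype.ext (perm_eq_of_forall_lt fun u v huv => ?_)
  have hne : u ≠ v := fun he => by simp [he] at huv
  rcases lt_or_gt_of_ne hne with hlt | hlt
  · by_contra hcon
    have h1 : IsInv b.1 u v := ⟨hlt, lt_of_le_of_ne (not_lt.1 hcon)
      fun he => hne (b.1.symm.injective he).symm⟩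
    rw [isInv_iff, ← h, ← isInv_iff] at h1
    exact absurd h1.2 (not_lt.2 huv.le)
  · have h1 : IsInv a.1 v u := ⟨hlt, huv⟩
    rw [isInv_iff, h, ← isInv_iff] at h1
    exact h1.2

/-- The linear order encoded by a bracket vector. -/
def BrBefore (L : ℕ → ℕ) (y x : ℕ) : Prop := (y < x ∧ L x ≤ y) ∨ (x < y ∧ x < L y)

theorem BrBefore.trans {L : ℕ → ℕ} (hL : BrValid L) {x y z : ℕ} (h1 : BrBefore L x y)
    (h2 : BrBefore L y z) : BrBefore L x z := by
  have a1 := hL.2 y x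
  have a2 := hL.2 z y
  have a3 := hL.2 x z
  have a4 := hL.2 x y
  have a5 := hL.2 y z
  have a6 := hL.2 z x
  have b1 := hL.1 x
  have b2 := hL.1 y
  have b3 := hL.1 z
  unfold BrBefore at *
  omega

theorem exists_bracket_eq {n : ℕ} {L : ℕ → ℕ} (hL : BrValid L) (h0 : ∀ x, n ≤ x → L x = 0) :
    ∃ a : TamL n, bracket a = L := by
  have hirr : ∀ x, ¬ BrBefore L x x := fun x h => by unfold BrBefore at h; omega
  have htot : ∀ x y, x ≠ y → BrBefore L x y ∨ BrBefore L y x := fun x y h => by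
    unfold BrBefore; omega
  let f : Fin n → Fin n := fun x =>
    ⟨(Finset.univ.filter fun y : Fin n => BrBefore L y x).card, by
      refine lt_of_lt_of_eq (Finset.card_lt_univ_of_notMem (x := x) ?_) (Fintype.card_fin n)
      simpa using hirr x⟩
  have hf : ∀ y x : Fin n, BrBefore L y x → f y < f x := by
    intro y x hyx
    change (Finset.univ.filter fun z : Fin n => BrBefore L z y).card <
      (Finset.univ.filter fun z : Fin n => BrBefore L z x).card
    refine Finset.card_lt_card
      ((Finset.ssubset_iff_of_subset fun w hw => ?_).2 ⟨y, ?_, ?_⟩)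
    · simp only [Finset.mem_filter, Finset.mem_univ, true_and] at hw ⊢
      exact hw.trans hL hyx
    · simpa using hyx
    · simpa using hirr y
  have hinj : Function.Injective f := by
    intro x y h
    by_contra hne
    rcases htot x y (fun he => hne (Fin.ext he)) with h1 | h1
    · exact (hf _ _ h1).ne h
    · exact (hf _ _ h1).ne' h
  have hfi : ∀ y x : Fin n, f y < f x ↔ BrBefore L y x := by
    refine fun y x => ⟨fun h => ?_, hf y x⟩
    have hne : (y : ℕ) ≠ x := fun he => by rw [Fin.ext he] at h; exact lt_irrefl _ h
    exact (htot y x hne).resolve_right fun h1 => absurd (hf _ _ h1) (not_lt.2 h.le)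
  let g : Equiv.Perm (Fin n) := Equiv.ofBijective f (Finite.injective_iff_bijective.1 hinj)
  let σ : Equiv.Perm (Fin n) := (Fin.revPerm.trans g).symm
  have hσ : ∀ u, σ.symm u = f (Fin.rev u) := fun u => rfl
  have hpos : ∀ x (h : x < n), permPos σ x = f ⟨x, h⟩ := fun x h => by
    simp [permPos, h, hσ]
  have hbef : ∀ y x, y < n → x < n → (permPos σ y < permPos σ x ↔ BrBefore L y x) := by
    intro y x hy hx
    rw [hpos y hy, hpos x hx, ← Fin.lt_def, hfi]
  have hav : Av312 σ := by
    rintro ⟨i1, i2, i3, h12, h23, h31, h32⟩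
    have e : ∀ i, f (Fin.rev (σ i)) = i := fun i => by rw [← hσ]; simp
    rw [← e i1, ← e i2, hfi] at h12
    rw [← e i2, ← e i3, hfi] at h23
    have hh1 := Fin.rev_lt_rev.2 h31
    have hh2 := Fin.rev_lt_rev.2 h32
    rw [Fin.lt_def] at hh1 hh2
    have a1 := hL.2 (Fin.rev (σ i2)) (Fin.rev (σ i3))
    unfold BrBefore at h12 h23
    omega
  obtain ⟨a, ha⟩ : ∃ a : TamL n, a.1 = σ := ⟨⟨σ, hav⟩, rfl⟩
  refine ⟨a, funext fun x => ?_⟩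
  by_cases hx : x < n
  · refine eq_of_forall_ge_iff fun y => ?_
    by_cases hyx : y ≤ x
    · rw [bracket_le_iff _ hyx, ha]
      rcases hyx.eq_or_lt with rfl | hyx
      · exact iff_of_true le_rfl (hL.1 y)
      · have h1 := hbef y x (hyx.trans hx) hx
        have h2 : permPos σ y ≠ permPos σ x := fun he => hyx.ne (permPos_injective σ he)
        rw [h2.le_iff_lt, h1]
        unfold BrBefore
        omega
    · exact iff_of_true ((bracket_spec _ x).1.trans (by omega)) ((hL.1 x).trans (by omega))
  · rw [bracket_of_le _ (not_lt.1 hx), h0 x (not_lt.1 hx)]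

theorem bracket_tamTop (n : ℕ) : bracket (tamTop n) = 0 := by
  funext x
  by_cases hx : x < n
  · refine Nat.le_zero.1 ((bracket_le_iff _ (Nat.zero_le x)).2 ?_)
    have hn : 0 < n := by omega
    simp [permPos, hx, hn, tamTop]
  · exact bracket_of_le _ (not_lt.1 hx)

theorem bracket_tamBot (n : ℕ) {x : ℕ} (hx : x < n) : bracket (tamBot n) x = x := by
  obtain ⟨h1, h2⟩ := bracket_spec (tamBot n) x
  have h3 : ∀ y < n, permPos (tamBot n).1 y = n - 1 - y := fun y hy => by
    have h : (tamBot n).1.symm (Fin.rev ⟨y, hy⟩) = Fin.rev ⟨y, hy⟩ := rfl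
    rw [permPos, dif_pos hy, h, Fin.val_rev]
    simp only
    omega
  rw [h3 _ hx, h3 _ (h1.trans_lt hx)] at h2
  omega

/-! ### Random subsets -/

section RandomSubset

variable {ι κ : Type*} {p : ℝ}

/-- Expectation of `f` at the random subset of `W` that contains every element independently with
probability `p`. -/
def subsetExp (p : ℝ) (W : Finset ι) (f : Finset ι → ℝ) : ℝ :=
  ∑ S ∈ W.powerset, p ^ S.card * (1 - p) ^ (W.card - S.card) * f S

/-- Probability that the random subset of `W` satisfies `E`. -/
def subsetProb (p : ℝ) (W : Finset ι) (E : Finset ι → Prop) : ℝ :=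
  subsetExp p W fun S => if E S then 1 else 0

theorem subsetExp_empty (f : Finset ι → ℝ) : subsetExp p ∅ f = f ∅ := by simp [subsetExp]

theorem subsetExp_congr {W : Finset ι} {f g : Finset ι → ℝ} (h : ∀ S ⊆ W, f S = g S) :
    subsetExp p W f = subsetExp p W g :=
  Finset.sum_congr rfl fun S hS => by rw [h S (Finset.mem_powerset.1 hS)]

theorem subsetProb_congr {W : Finset ι} {E F : Finset ι → Prop} (h : ∀ S ⊆ W, (E S ↔ F S)) :
    subsetProb p W E = subsetProb p W F :=
  subsetExp_congr fun S hS => by simp only [h S hS]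

theorem subsetExp_add (W : Finset ι) (f g : Finset ι → ℝ) :
    subsetExp p W (fun S => f S + g S) = subsetExp p W f + subsetExp p W g := by
  simp only [subsetExp, mul_add, Finset.sum_add_distrib]

theorem subsetExp_const_mul (W : Finset ι) (c : ℝ) (f : Finset ι → ℝ) :
    subsetExp p W (fun S => c * f S) = c * subsetExp p W f := by
  simp only [subsetExp, Finset.mul_sum]
  exact Finset.sum_congr rfl fun S _ => by ring

theorem subsetExp_sum (W : Finset ι) (J : Finset κ) (f : κ → Finset ι → ℝ) :
    subsetExp p W (fun S => ∑ j ∈ J, f j S) = ∑ j ∈ J, subsetExp p W (f j) := by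
  simp only [subsetExp, Finset.mul_sum]
  rw [Finset.sum_comm]

theorem subsetExp_mono (hp0 : 0 ≤ p) (hp1 : p ≤ 1) {W : Finset ι} {f g : Finset ι → ℝ}
    (h : ∀ S ⊆ W, f S ≤ g S) : subsetExp p W f ≤ subsetExp p W g := by
  refine Finset.sum_le_sum fun S hS => mul_le_mul_of_nonneg_left
    (h S (Finset.mem_powerset.1 hS)) ?_
  have : 0 ≤ 1 - p := by linarith
  positivity

theorem subsetExp_nonneg (hp0 : 0 ≤ p) (hp1 : p ≤ 1) {W : Finset ι} {f : Finset ι → ℝ}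
    (h : ∀ S ⊆ W, 0 ≤ f S) : 0 ≤ subsetExp p W f := by
  have := subsetExp_mono hp0 hp1 (f := fun _ => 0) h
  simpa [subsetExp] using this

theorem subsetProb_nonneg (hp0 : 0 ≤ p) (hp1 : p ≤ 1) (W : Finset ι) (E : Finset ι → Prop) :
    0 ≤ subsetProb p W E :=
  subsetExp_nonneg hp0 hp1 fun S _ => by split_ifs <;> norm_num

theorem subsetProb_mono (hp0 : 0 ≤ p) (hp1 : p ≤ 1) {W : Finset ι} {E F : Finset ι → Prop}
    (h : ∀ S ⊆ W, E S → F S) : subsetProb p W E ≤ subsetProb p W F :=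
  subsetExp_mono hp0 hp1 fun S hS => by
    by_cases hE : E S
    · simp [hE, h S hS hE]
    · simp only [hE, if_false]; split_ifs <;> norm_num

/-- Union bound for a sum of indicator functions. -/
theorem subsetProb_exists_le (hp0 : 0 ≤ p) (hp1 : p ≤ 1) (W : Finset ι) (J : Finset κ)
    (E : κ → Finset ι → Prop) :
    subsetProb p W (fun S => ∃ j ∈ J, E j S) ≤ ∑ j ∈ J, subsetProb p W (E j) := by
  simp only [subsetProb, ← subsetExp_sum]
  refine subsetExp_mono hp0 hp1 fun S _ => ?_
  have h0 : ∀ j ∈ J, (0 : ℝ) ≤ if E j S then 1 else 0 := fun j _ => by split_ifs <;> norm_num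
  split_ifs with h
  · obtain ⟨j, hj, hE⟩ := h
    refine le_trans ?_ (Finset.single_le_sum h0 hj)
    simp [hE]
  · exact Finset.sum_nonneg h0

theorem sum_subsetProb_le (hp0 : 0 ≤ p) (hp1 : p ≤ 1) (W : Finset ι) (J : Finset κ)
    (E : κ → Finset ι → Prop) (F : Finset ι → Prop) (hEF : ∀ j ∈ J, ∀ S ⊆ W, E j S → F S)
    (hd : ∀ S ⊆ W, ∀ i ∈ J, ∀ j ∈ J, E i S → E j S → i = j) :
    ∑ j ∈ J, subsetProb p W (E j) ≤ subsetProb p W F := by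
  simp only [subsetProb, ← subsetExp_sum]
  refine subsetExp_mono hp0 hp1 fun S hS => ?_
  by_cases h : ∃ j ∈ J, E j S
  · obtain ⟨j, hj, hE⟩ := h
    rw [Finset.sum_eq_single_of_mem j hj fun i hi hij =>
      if_neg fun hE' => hij (hd S hS i hi j hj hE' hE)]
    rw [if_pos hE, if_pos (hEF j hj S hS hE)]
  · push Not at h
    rw [Finset.sum_eq_zero fun j hj => if_neg (h j hj)]
    split_ifs <;> norm_num

theorem subsetProb_or_le (hp0 : 0 ≤ p) (hp1 : p ≤ 1) (W : Finset ι) (E F : Finset ι → Prop) :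
    subsetProb p W (fun S => E S ∨ F S) ≤ subsetProb p W E + subsetProb p W F := by
  simp only [subsetProb, ← subsetExp_add]
  refine subsetExp_mono hp0 hp1 fun S _ => ?_
  by_cases h1 : E S <;> by_cases h2 : F S <;> simp [h1, h2]

variable [DecidableEq ι]

theorem subsetExp_insert {W : Finset ι} {i : ι} (hi : i ∉ W) (f : Finset ι → ℝ) :
    subsetExp p (insert i W) f =
      p * subsetExp p W (fun S => f (insert i S)) + (1 - p) * subsetExp p W f := by
  rw [subsetExp, Finset.sum_powerset_insert hi, add_comm, subsetExp, subsetExp, Finset.mul_sum,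
    Finset.mul_sum]
  congr 1
  · refine Finset.sum_congr rfl fun S hS => ?_
    have hS := Finset.mem_powerset.1 hS
    rw [Finset.card_insert_of_notMem (fun h => hi (hS h)), Finset.card_insert_of_notMem hi,
      Nat.add_sub_add_right]
    ring
  · refine Finset.sum_congr rfl fun S hS => ?_
    have hS := Finset.card_le_card (Finset.mem_powerset.1 hS)
    rw [Finset.card_insert_of_notMem hi, Nat.sub_add_comm hS]
    ring

theorem subsetExp_map [DecidableEq κ] (W : Finset ι) (e : ι ↪ κ) (f : Finset κ → ℝ) :
    subsetExp p (W.map e) f = subsetExp p W fun S => f (S.map e) := by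
  induction W using Finset.induction_on generalizing f with
  | empty => simp [subsetExp_empty]
  | insert i W hi ih =>
    rw [Finset.map_insert, subsetExp_insert (by simpa using hi), subsetExp_insert hi, ih, ih]
    simp only [Finset.map_insert]

theorem subsetExp_union {U V : Finset ι} (h : Disjoint U V) (f : Finset ι → ℝ) :
    subsetExp p (U ∪ V) f = subsetExp p U fun S => subsetExp p V fun T => f (S ∪ T) := by
  induction U using Finset.induction_on generalizing f with
  | empty => simp [subsetExp_empty]
  | insert i U hi ih =>
    rw [Finset.disjoint_insert_left] at h
    rw [Finset.insert_union, subsetExp_insert (by simp [hi, h.1]), subsetExp_insert hi,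
      ih h.2, ih h.2]
    simp only [Finset.insert_union]

/-- Expectation of a product of functions of the coordinates. -/
theorem subsetExp_prod (W : Finset ι) (α β : ι → ℝ) :
    subsetExp p W (fun S => ∏ i ∈ W, if i ∈ S then α i else β i) =
      ∏ i ∈ W, (p * α i + (1 - p) * β i) := by
  induction W using Finset.induction_on with
  | empty => simp [subsetExp_empty]
  | insert i W hi ih =>
    rw [subsetExp_insert hi, Finset.prod_insert hi, ← ih]
    have h1 : subsetExp p W (fun S => ∏ j ∈ insert i W, if j ∈ insert i S then α j else β j) =
        α i * subsetExp p W (fun S => ∏ j ∈ W, if j ∈ S then α j else β j) := by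
      rw [← subsetExp_const_mul]
      refine subsetExp_congr fun S hS => ?_
      rw [Finset.prod_insert hi, if_pos (Finset.mem_insert_self _ _)]
      refine congrArg _ (Finset.prod_congr rfl fun j hj => ?_)
      have : j ≠ i := fun he => hi (he ▸ hj)
      simp [this]
    have h2 : subsetExp p W (fun S => ∏ j ∈ insert i W, if j ∈ S then α j else β j) =
        β i * subsetExp p W (fun S => ∏ j ∈ W, if j ∈ S then α j else β j) := by
      rw [← subsetExp_const_mul]
      refine subsetExp_congr fun S hS => ?_
      rw [Finset.prod_insert hi, if_neg (fun h => hi (hS h))]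
    rw [h1, h2]
    ring

theorem subsetExp_const (W : Finset ι) (c : ℝ) : subsetExp p W (fun _ => c) = c := by
  have := subsetExp_prod (p := p) W (fun _ => 1) (fun _ => 1)
  simp only [ite_self, Finset.prod_const_one, mul_one, add_sub_cancel] at this
  have h2 := subsetExp_const_mul (p := p) W c (fun _ => 1)
  simpa [this] using h2

theorem subsetExp_marginal {U W : Finset ι} (hU : U ⊆ W) {f : Finset ι → ℝ}
    (hf : ∀ S, f S = f (S ∩ U)) : subsetExp p W f = subsetExp p U f := by
  have h : W = U ∪ (W \ U) := by simp [Finset.union_eq_right.2 hU]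
  rw [h, subsetExp_union Finset.disjoint_sdiff]
  refine subsetExp_congr fun S hS => ?_
  rw [← subsetExp_const (p := p) (W \ U) (f S)]
  refine subsetExp_congr fun T hT => ?_
  rw [hf]
  congr 1
  ext i
  have h1 := @hS i
  have h2 := @hT i
  simp only [Finset.mem_inter, Finset.mem_union, Finset.mem_sdiff] at *
  tauto

theorem subsetExp_mul_of_disjoint {U V W : Finset ι} (hU : U ⊆ W) (hV : V ⊆ W)
    (hUV : Disjoint U V) {f g : Finset ι → ℝ} (hf : ∀ S, f S = f (S ∩ U))
    (hg : ∀ S, g S = g (S ∩ V)) :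
    subsetExp p W (fun S => f S * g S) = subsetExp p W f * subsetExp p W g := by
  have h1 : ∀ S, f S * g S = f (S ∩ (U ∪ V)) * g (S ∩ (U ∪ V)) := fun S => by
    rw [hf S, hg S, hf (S ∩ (U ∪ V)), hg (S ∩ (U ∪ V)), Finset.inter_assoc, Finset.inter_assoc,
      Finset.union_inter_cancel_left, Finset.union_inter_cancel_right]
  rw [subsetExp_marginal (Finset.union_subset hU hV) h1, subsetExp_union hUV,
    subsetExp_marginal hU hf, subsetExp_marginal hV hg, mul_comm, ← subsetExp_const_mul]
  refine subsetExp_congr fun S hS => ?_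
  rw [mul_comm, ← subsetExp_const_mul]
  refine subsetExp_congr fun T hT => ?_
  have h3 : (S ∪ T) ∩ U = S := by
    ext i
    have h1 := @hS i
    have h2 := @hT i
    have h3 : i ∈ U → i ∈ V → False := fun a b => Finset.disjoint_left.1 hUV a b
    simp only [Finset.mem_inter, Finset.mem_union] at *
    tauto
  have h4 : (S ∪ T) ∩ V = T := by
    ext i
    have h1 := @hS i
    have h2 := @hT i
    have h3 : i ∈ U → i ∈ V → False := fun a b => Finset.disjoint_left.1 hUV a b
    simp only [Finset.mem_inter, Finset.mem_union] at *
    tauto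
  rw [hf, hg, h3, h4]

theorem subsetProb_and_of_disjoint {U V W : Finset ι} (hU : U ⊆ W) (hV : V ⊆ W)
    (hUV : Disjoint U V) {E F : Finset ι → Prop} (hE : ∀ S, E S ↔ E (S ∩ U))
    (hF : ∀ S, F S ↔ F (S ∩ V)) :
    subsetProb p W (fun S => E S ∧ F S) = subsetProb p W E * subsetProb p W F := by
  rw [subsetProb, subsetProb, subsetProb, ← subsetExp_mul_of_disjoint hU hV hUV]
  · exact subsetExp_congr fun S _ => by by_cases h1 : E S <;> by_cases h2 : F S <;> simp [h1, h2]
  · exact fun S => by simp only [← hE S]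
  · exact fun S => by simp only [← hF S]

/-- The random subset of `W` is invariant under permutations of `W`. -/
theorem subsetProb_map_equiv {W : Finset ι} (e : ι ≃ ι) (he : W.map e.toEmbedding = W)
    (E : Finset ι → Prop) :
    subsetProb p W E = subsetProb p W fun S => E (S.map e.toEmbedding) := by
  conv_lhs => rw [subsetProb, ← he, subsetExp_map]
  rfl

end RandomSubset

/-! ### The Ungarian chain on the Tamari lattice in terms of bracket vectors -/

/-- The simultaneous move of all indices in `S`. -/
theorem exists_tamStep {n : ℕ} (S : Finset ℕ) (a : TamL n) :
    ∃ b : TamL n, bracket b = brStep (fun c => decide (c ∈ S ∧ c < n)) (bracket a) := by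
  refine exists_bracket_eq (brStep_valid (bracket_valid a) _) fun x hx => ?_
  simp [brStep, not_lt.2 hx, bracket_of_le a hx]

/-- The element reached from `a` by moving all indices in `S` simultaneously. -/
def tamStep {n : ℕ} (S : Finset ℕ) (a : TamL n) : TamL n := (exists_tamStep S a).choose

theorem bracket_tamStep {n : ℕ} (S : Finset ℕ) (a : TamL n) :
    bracket (tamStep S a) = brStep (fun c => decide (c ∈ S ∧ c < n)) (bracket a) :=
  (exists_tamStep S a).choose_spec

/-- The indices of `a` that can still move. -/
def unsettled {n : ℕ} (a : TamL n) : Finset ℕ := (Finset.range n).filter fun x => bracket a x < x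

theorem mem_unsettled {n : ℕ} {a : TamL n} {x : ℕ} : x ∈ unsettled a ↔ x < n ∧ bracket a x < x := by
  simp [unsettled]

theorem bracket_tamStep_of_mem {n : ℕ} {S : Finset ℕ} {a : TamL n} {x : ℕ} (hx : x ∈ unsettled a)
    (hS : x ∈ S) : bracket (tamStep S a) x = brPrev (bracket a) x + 1 := by
  rw [mem_unsettled] at hx
  simp [bracket_tamStep, brStep, hx, hS]

theorem bracket_tamStep_of_notMem {n : ℕ} {S : Finset ℕ} {a : TamL n} {x : ℕ}
    (h : x ∉ S ∩ unsettled a) : bracket (tamStep S a) x = bracket a x := by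
  rw [Finset.mem_inter, mem_unsettled] at h
  rw [bracket_tamStep, brStep, if_neg]
  simp only [decide_eq_true_eq]
  tauto

theorem tamStep_inter_unsettled {n : ℕ} (S : Finset ℕ) (a : TamL n) :
    tamStep (S ∩ unsettled a) a = tamStep S a := by
  refine bracket_injective (funext fun x => ?_)
  by_cases hx : x ∈ S ∩ unsettled a
  · rw [bracket_tamStep_of_mem (Finset.mem_inter.1 hx).2 hx,
      bracket_tamStep_of_mem (Finset.mem_inter.1 hx).2 (Finset.mem_inter.1 hx).1]
  · rw [bracket_tamStep_of_notMem hx, bracket_tamStep_of_notMem]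
    simp only [Finset.mem_inter] at *
    tauto

theorem tamStep_le {n : ℕ} (S : Finset ℕ) (a : TamL n) : tamLe (tamStep S a) a := by
  rw [tamLe_iff, bracket_tamStep]
  exact le_brStep (bracket_valid a) _

theorem tamLe_antisymm {n : ℕ} {a b : TamL n} (h1 : tamLe a b) (h2 : tamLe b a) : a = b := by
  rw [tamLe_iff] at h1 h2
  exact bracket_injective (funext fun x => le_antisymm (h2 x) (h1 x))

theorem covRel_iff {n : ℕ} (a b : TamL n) :
    Ungarian.CovRel (fun a b : TamL n => tamLe a b) a b ↔ ∃ x ∈ unsettled a, tamStep {x} a = b := by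
  have hoff : ∀ x y, y ≠ x → bracket (tamStep {x} a) y = bracket a y := fun x y h =>
    bracket_tamStep_of_notMem (by simp [h])
  have hva := bracket_valid a
  constructor
  · rintro ⟨hle, hne, hcov⟩
    rw [tamLe_iff] at hle
    have hex : ∃ x, bracket a x ≠ bracket b x := by
      by_contra hcon
      push Not at hcon
      exact hne (bracket_injective (funext fun x => (hcon x).symm))
    set x := Nat.find hex
    have hx : bracket a x ≠ bracket b x := Nat.find_spec hex
    have hmin : ∀ y < x, bracket a y = bracket b y := fun y hy => by
      simpa using Nat.find_min hex hy
    have hlt : bracket a x < bracket b x := lt_of_le_of_ne (hle x) hx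
    have hxn : x < n := by
      by_contra hcon
      rw [bracket_of_le b (not_lt.1 hcon)] at hlt
      omega
    have hu : x ∈ unsettled a := mem_unsettled.2 ⟨hxn, hlt.trans_le ((bracket_valid b).1 x)⟩
    have hp := brPrev_spec hva (mem_unsettled.1 hu).2
    have hbx : brPrev (bracket a) x + 1 ≤ bracket b x := by
      by_contra hcon
      have h1 := (bracket_valid b).2 x (brPrev (bracket a) x) (by omega) hp.1.le
      rw [← hmin _ hp.1, hp.2] at h1
      omega
    have hstep := bracket_tamStep_of_mem hu (Finset.mem_singleton_self x)
    refine ⟨x, hu, ?_⟩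
    refine (hcov (tamStep {x} a) ?_ (tamStep_le _ _)).resolve_right fun he => ?_
    · refine (tamLe_iff _ _).2 fun y => ?_
      by_cases hy : y = x
      · rw [hy, hstep]; exact hbx
      · rw [hoff x y hy]; exact hle y
    · rw [he] at hstep
      have := self_le_brPrev hva (mem_unsettled.1 hu).2
      omega
  · rintro ⟨x, hu, rfl⟩
    have hstep := bracket_tamStep_of_mem hu (Finset.mem_singleton_self x)
    have hself := self_le_brPrev hva (mem_unsettled.1 hu).2
    have hp := brPrev_spec hva (mem_unsettled.1 hu).2
    refine ⟨tamStep_le _ _, fun he => ?_, fun z h1 h2 => ?_⟩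
    · rw [he] at hstep
      omega
    · replace h1 := (tamLe_iff _ _).1 h1
      replace h2 := (tamLe_iff _ _).1 h2
      have hz : ∀ y, y ≠ x → bracket z y = bracket a y := fun y hy =>
        le_antisymm ((h1 y).trans_eq (hoff x y hy)) (h2 y)
      rcases (h2 x).eq_or_lt with he | hlt
      · right
        refine bracket_injective (funext fun y => ?_)
        by_cases hy : y = x
        · rw [hy, he]
        · exact hz y hy
      · left
        refine bracket_injective (funext fun y => ?_)
        by_cases hy : y = x
        · rw [hy, hstep]
          have h3 := h1 x
          rw [hstep] at h3
          refine le_antisymm h3 ?_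
          by_contra hcon
          have h4 := (bracket_valid z).2 x (brPrev (bracket a) x) (by omega) hp.1.le
          rw [hz _ hp.1.ne, hp.2] at h4
          omega
        · rw [hz y hy, hoff x y hy]

theorem covFinset_eq {n : ℕ} (a : TamL n) :
    Ungarian.covFinset (fun a b : TamL n => tamLe a b) a =
      (unsettled a).image fun x => tamStep {x} a := by
  ext b
  simp only [Ungarian.covFinset, Finset.mem_filter, Finset.mem_univ, true_and, covRel_iff,
    Finset.mem_image]

theorem injOn_tamStep_singleton {n : ℕ} (a : TamL n) :
    Set.InjOn (fun x => tamStep {x} a) (unsettled a : Set ℕ) := by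
  intro x hx y hy h
  by_contra hne
  have h1 := bracket_tamStep_of_mem hx (Finset.mem_singleton_self x)
  have h2 := self_le_brPrev (bracket_valid a) (mem_unsettled.1 hx).2
  have h3 : bracket (tamStep {y} a) x = bracket a x :=
    bracket_tamStep_of_notMem (by simp [hne])
  simp only at h
  rw [h] at h1
  omega

theorem meetOf_image {n : ℕ} (a : TamL n) {S : Finset ℕ} (hS : S ⊆ unsettled a) :
    Ungarian.meetOf (fun a b : TamL n => tamLe a b) a (S.image fun x => tamStep {x} a) =
      tamStep S a := by
  have hm : Ungarian.IsMeetOf (fun a b : TamL n => tamLe a b)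
      (insert a ((S.image fun x => tamStep {x} a : Finset (TamL n)) : Set (TamL n)))
      (tamStep S a) := by
    constructor
    · intro s hs
      rcases Set.mem_insert_iff.1 hs with rfl | hs
      · exact tamStep_le _ _
      · simp only [Finset.coe_image, Set.mem_image, Finset.mem_coe] at hs
        obtain ⟨x, hx, rfl⟩ := hs
        rw [tamLe_iff]
        intro y
        by_cases hy : y = x
        · rw [hy, bracket_tamStep_of_mem (hS hx) (Finset.mem_singleton_self x),
            bracket_tamStep_of_mem (hS hx) hx]
        · rw [bracket_tamStep_of_notMem (by simp [hy])]
          exact (tamLe_iff _ _).1 (tamStep_le S a) y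
    · intro z hz
      rw [tamLe_iff]
      intro y
      by_cases hy : y ∈ S
      · have h1 := (tamLe_iff _ _).1 (hz (tamStep {y} a) (Set.mem_insert_of_mem _ (by
          simp only [Finset.coe_image]; exact ⟨y, hy, rfl⟩))) y
        rw [bracket_tamStep_of_mem (hS hy) (Finset.mem_singleton_self y)] at h1
        rwa [bracket_tamStep_of_mem (hS hy) hy]
      · rw [bracket_tamStep_of_notMem (by simp [hy])]
        exact (tamLe_iff _ _).1 (hz a (Set.mem_insert _ _)) y
  have hex : ∃ m, Ungarian.IsMeetOf (fun a b : TamL n => tamLe a b)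
      (insert a ((S.image fun x => tamStep {x} a : Finset (TamL n)) : Set (TamL n))) m := ⟨_, hm⟩
  rw [Ungarian.meetOf, dif_pos hex]
  exact tamLe_antisymm (hm.2 _ hex.choose_spec.1) (hex.choose_spec.2 _ hm.1)

theorem stepProb_eq {n : ℕ} {p : ℝ} (hp0 : 0 ≤ p) (hp1 : p ≤ 1) (a b : TamL n) :
    Ungarian.stepProb p (fun a b : TamL n => tamLe a b) a b =
      ENNReal.ofReal (subsetProb p (Finset.range n) fun S => tamStep S a = b) := by
  have hq : 0 ≤ 1 - p := by linarith
  have hU : unsettled a ⊆ Finset.range n := Finset.filter_subset _ _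
  rw [subsetProb, subsetExp_marginal hU (fun S => by rw [tamStep_inter_unsettled]), subsetExp,
    ENNReal.ofReal_sum_of_nonneg (fun S _ => mul_nonneg (by positivity)
      (by split_ifs <;> norm_num)), Ungarian.stepProb, covFinset_eq]
  have hinj := injOn_tamStep_singleton a
  symm
  refine Finset.sum_bij (fun S _ => S.image fun x => tamStep {x} a) (fun S hS => ?_)
    (fun S hS T hT h => ?_) (fun T hT => ?_) (fun S hS => ?_)
  · exact Finset.mem_powerset.2 (Finset.image_subset_image (Finset.mem_powerset.1 hS))
  · have h1 := Finset.mem_powerset.1 hS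
    have h2 := Finset.mem_powerset.1 hT
    have h3 := congrArg (fun s : Finset (TamL n) => (s : Set (TamL n))) h
    simp only [Finset.coe_image] at h3
    exact Finset.coe_injective ((hinj.image_eq_image_iff (by exact_mod_cast h1)
      (by exact_mod_cast h2)).1 h3)
  · obtain ⟨S, hS, rfl⟩ := Finset.subset_image_iff.1 (Finset.mem_powerset.1 hT)
    exact ⟨S, Finset.mem_powerset.2 (by exact_mod_cast hS), rfl⟩
  · have h1 := Finset.mem_powerset.1 hS
    rw [meetOf_image a h1, Finset.card_image_of_injOn hinj,
      Finset.card_image_of_injOn (hinj.mono (by exact_mod_cast h1))]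
    split_ifs <;> simp

/-- The activations encoded by a set of pairs (time, index). -/
def actOf (S : Finset (ℕ × ℕ)) (s c : ℕ) : Bool := decide ((s, c) ∈ S)

/-- The space-time window with `t` time steps and `n` indices. -/
abbrev window (t n : ℕ) : Finset (ℕ × ℕ) := Finset.range t ×ˢ Finset.range n

theorem subsetProb_window_succ {p : ℝ} (t n : ℕ) (E : Finset (ℕ × ℕ) → Prop) :
    subsetProb p (window (t + 1) n) E = subsetExp p (window t n) fun S =>
      subsetProb p (Finset.range n) fun T =>
        E (S ∪ T.map ⟨fun c => (t, c), Prod.mk_right_injective t⟩) := by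
  have h1 : window (t + 1) n = window t n ∪
      (Finset.range n).map ⟨fun c => (t, c), Prod.mk_right_injective t⟩ := by
    ext ⟨s, c⟩
    simp only [window, Finset.mem_product, Finset.mem_range, Finset.mem_union, Finset.mem_map,
      Function.Embedding.coeFn_mk, Prod.mk.injEq]
    constructor
    · rintro ⟨h1, h2⟩
      rcases (Nat.lt_succ_iff.1 h1).eq_or_lt with rfl | h
      · exact Or.inr ⟨c, h2, rfl, rfl⟩
      · exact Or.inl ⟨h, h2⟩
    · rintro (⟨h1, h2⟩ | ⟨d, h1, rfl, rfl⟩)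
      · exact ⟨by omega, h2⟩
      · exact ⟨by omega, h1⟩
  have h2 : Disjoint (window t n)
      ((Finset.range n).map ⟨fun c => (t, c), Prod.mk_right_injective t⟩) := by
    rw [Finset.disjoint_left]
    rintro ⟨s, c⟩ h1 h2
    simp only [window, Finset.mem_product, Finset.mem_range, Finset.mem_map,
      Function.Embedding.coeFn_mk, Prod.mk.injEq] at h1 h2
    obtain ⟨_, _, rfl, _⟩ := h2
    omega
  rw [subsetProb, h1, subsetExp_union h2]
  simp only [subsetExp_map, subsetProb]

theorem bracket_eq_brRun_zero {S : Finset (ℕ × ℕ)} {n t : ℕ} (hS : S ⊆ window t n) (s : ℕ) {x : ℕ}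
    (hx : n ≤ x) : brRun (actOf S) s x = 0 := by
  refine brRun_eq_zero fun r _ => ?_
  simp only [actOf, decide_eq_false_iff_not]
  intro h
  have := hS h
  simp only [window, Finset.mem_product, Finset.mem_range] at this
  omega

theorem walk_eq {n : ℕ} {p : ℝ} (hp0 : 0 ≤ p) (hp1 : p ≤ 1) (t : ℕ) (b : TamL n) :
    Ungarian.walk p (fun a b : TamL n => tamLe a b) (tamTop n) t b =
      ENNReal.ofReal (subsetProb p (window t n) fun S => brRun (actOf S) t = bracket b) := by
  induction t generalizing b with
  | zero =>
    have h : window 0 n = ∅ := by simp [window]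
    rw [Ungarian.walk, subsetProb, h, subsetExp_empty]
    have h1 : (brRun (actOf ∅) 0 = bracket b) ↔ b = tamTop n := by
      rw [← bracket_injective.eq_iff, bracket_tamTop, eq_comm]
      rfl
    simp only [h1]
    split_ifs <;> simp
  | succ t ih =>
    simp only [Ungarian.walk, ih, stepProb_eq hp0 hp1]
    have h1 : ∀ z : TamL n, ENNReal.ofReal (subsetProb p (window t n) fun S =>
        brRun (actOf S) t = bracket z) *
        ENNReal.ofReal (subsetProb p (Finset.range n) fun T => tamStep T z = b) =
        ENNReal.ofReal (subsetProb p (Finset.range n) (fun T => tamStep T z = b) *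
          subsetProb p (window t n) fun S => brRun (actOf S) t = bracket z) := fun z => by
      rw [mul_comm, ENNReal.ofReal_mul (subsetProb_nonneg hp0 hp1 _ _)]
    simp only [h1]
    rw [← ENNReal.ofReal_sum_of_nonneg fun z _ => mul_nonneg (subsetProb_nonneg hp0 hp1 _ _)
      (subsetProb_nonneg hp0 hp1 _ _)]
    congr 1
    rw [subsetProb_window_succ]
    conv_lhs =>
      enter [2, z]
      rw [subsetProb.eq_1 p (window t n), ← subsetExp_const_mul]
    rw [← subsetExp_sum]
    refine subsetExp_congr fun S hS => ?_
    obtain ⟨z, hz⟩ := exists_bracket_eq (n := n) (brRun_valid (actOf S) t)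
      fun x hx => bracket_eq_brRun_zero hS t hx
    rw [Finset.sum_eq_single_of_mem z (Finset.mem_univ z) fun w _ hw => by
      rw [if_neg (fun h => hw (bracket_injective (h.symm.trans hz.symm))), mul_zero]]
    rw [if_pos hz.symm, mul_one]
    refine subsetProb_congr fun T hT => ?_
    rw [← bracket_injective.eq_iff, bracket_tamStep]
    have h2 : brRun (actOf (S ∪ T.map ⟨fun c => (t, c), Prod.mk_right_injective t⟩)) (t + 1) =
        brStep (fun c => decide (c ∈ T ∧ c < n)) (bracket z) := by
      funext x
      refine brStep_congr (fun c _ => ?_) ?_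
      · rw [hz]
        refine brRun_congr fun s hs d _ => ?_
        simp [actOf, hs.ne']
      · have h3 : (t, x) ∉ S := fun h => by simpa [window] using hS h
        have h4 : x ∈ T → x < n := fun h => by simpa using hT h
        simp only [actOf, Finset.mem_union, h3, Finset.mem_map, Function.Embedding.coeFn_mk,
          Prod.mk.injEq, true_and, exists_eq_right, false_or]
        congr 1
        simp only [eq_iff_iff]
        tauto
    rw [h2]

/-- Probability that the chain has not reached the bottom element at time `t`. -/
def unfinishedProb (p : ℝ) (n t : ℕ) : ℝ :=
  subsetProb p (window t n) fun S => ∃ x < n, brRun (actOf S) t x < x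

theorem probIn_eq {n : ℕ} {p : ℝ} (hp0 : 0 ≤ p) (hp1 : p ≤ 1) (t : ℕ) :
    Ungarian.probIn p (fun a b : TamL n => tamLe a b) (tamTop n) t {y | y ≠ tamBot n} =
      ENNReal.ofReal (unfinishedProb p n t) := by
  simp only [Ungarian.probIn, walk_eq hp0 hp1]
  rw [← ENNReal.ofReal_sum_of_nonneg fun z _ => subsetProb_nonneg hp0 hp1 _ _]
  congr 1
  simp only [subsetProb, unfinishedProb, ← subsetExp_sum]
  refine subsetExp_congr fun S hS => ?_
  obtain ⟨z, hz⟩ := exists_bracket_eq (n := n) (brRun_valid (actOf S) t)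
    fun x hx => bracket_eq_brRun_zero hS t hx
  simp only [← hz, bracket_injective.eq_iff, Finset.sum_ite_eq, Finset.mem_filter,
    Finset.mem_univ, true_and, Set.mem_ofPred_eq]
  have h1 : z ≠ tamBot n ↔ ∃ x < n, bracket z x < x := by
    rw [← not_iff_not]
    push Not
    constructor
    · rintro rfl x hx
      exact (bracket_tamBot n hx).ge
    · intro h
      refine bracket_injective (funext fun x => ?_)
      by_cases hx : x < n
      · rw [bracket_tamBot n hx]
        exact le_antisymm ((bracket_valid z).1 x) (h x hx)
      · rw [bracket_of_le _ (not_lt.1 hx), bracket_of_le _ (not_lt.1 hx)]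
  simp only [h1]

theorem subsetProb_marginal {ι : Type*} [DecidableEq ι] {p : ℝ} {U W : Finset ι} (hU : U ⊆ W)
    {E : Finset ι → Prop} (hE : ∀ S, E S ↔ E (S ∩ U)) : subsetProb p W E = subsetProb p U E :=
  subsetExp_marginal hU fun S => by simp only [← hE S]

theorem subsetExp_prod_of_subset {ι : Type*} [DecidableEq ι] {p : ℝ} {U W : Finset ι} (hU : U ⊆ W)
    (α β : ι → ℝ) : subsetExp p W (fun S => ∏ i ∈ U, if i ∈ S then α i else β i) =
      ∏ i ∈ U, (p * α i + (1 - p) * β i) := by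
  rw [← subsetExp_prod]
  refine subsetExp_marginal hU fun S => Finset.prod_congr rfl fun i hi => ?_
  simp [hi]

theorem brRun_actOf_inter {U S : Finset (ℕ × ℕ)} {t x : ℕ} (h : ∀ s < t, ∀ d ≤ x, (s, d) ∈ U) :
    brRun (actOf (S ∩ U)) t x = brRun (actOf S) t x := by
  refine brRun_congr fun s hs d hd => ?_
  simp [actOf, h s hs d hd]

/-- The activation times of the index `c` in `[s, t)`. -/
abbrev column (c s t : ℕ) : Finset (ℕ × ℕ) := Finset.Ico s t ×ˢ {c}

theorem mem_column {c s t : ℕ} {i : ℕ × ℕ} : i ∈ column c s t ↔ (s ≤ i.1 ∧ i.1 < t) ∧ i.2 = c := by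
  rw [column, Finset.mem_product, Finset.mem_Ico, Finset.mem_singleton]

theorem mem_window {t n : ℕ} {i : ℕ × ℕ} : i ∈ window t n ↔ i.1 < t ∧ i.2 < n := by
  simp [window]

theorem column_subset_window {c s t H n : ℕ} (ht : t ≤ H) (hc : c < n) :
    column c s t ⊆ window H n := fun i hi => by
  rw [mem_column] at hi
  rw [mem_window]
  omega

theorem card_column (c s t : ℕ) : (column c s t).card = t - s := by simp [column]

theorem pow_actCount (r : ℝ) (S : Finset (ℕ × ℕ)) (c s t : ℕ) :
    r ^ actCount (actOf S) c s t = ∏ i ∈ column c s t, if i ∈ S then r else 1 := by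
  rw [column, Finset.prod_product, actCount, ← Finset.prod_const, Finset.prod_filter]
  refine Finset.prod_congr rfl fun x _ => ?_
  simp [actOf]

theorem subsetExp_pow_actCount {p : ℝ} (r : ℝ) {c s t H n : ℕ} (ht : t ≤ H) (hc : c < n) :
    subsetExp p (window H n) (fun S => r ^ actCount (actOf S) c s t) =
      (p * r + (1 - p)) ^ (t - s) := by
  simp only [pow_actCount]
  rw [subsetExp_prod_of_subset (column_subset_window ht hc), Finset.prod_const, card_column]
  ring

theorem unfinishedProb_antitone {p : ℝ} (hp0 : 0 ≤ p) (hp1 : p ≤ 1) (n : ℕ) :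
    Antitone (unfinishedProb p n) := by
  intro t T h
  have h1 : window t n ⊆ window T n := fun i hi => by
    rw [mem_window] at *
    omega
  have h2 : unfinishedProb p n t =
      subsetProb p (window T n) fun S => ∃ x < n, brRun (actOf S) t x < x := by
    refine (subsetProb_marginal h1 fun S => ?_).symm
    refine exists_congr fun x => and_congr_right fun hx => ?_
    rw [brRun_actOf_inter fun s hs d hd => mem_window.2 ⟨hs, by omega⟩]
  rw [h2]
  refine subsetProb_mono hp0 hp1 fun S _ => ?_
  rintro ⟨x, hx, hlt⟩
  exact ⟨x, hx, (brRun_mono (actOf S) x h).trans_lt hlt⟩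

theorem unfinishedProb_le {p : ℝ} (hp0 : 0 ≤ p) (hp1 : p ≤ 1) (n t : ℕ) :
    unfinishedProb p n t ≤ n * 2 ^ n * (1 - p / 2) ^ t := by
  have h1 : unfinishedProb p n t ≤
      ∑ x ∈ Finset.range n, subsetProb p (window t n) fun S => brRun (actOf S) t x < x := by
    refine le_trans (subsetProb_mono hp0 hp1 fun S _ => ?_)
      (subsetProb_exists_le hp0 hp1 _ _ _)
    rintro ⟨x, hx, hlt⟩
    exact ⟨x, Finset.mem_range.2 hx, hlt⟩
  refine h1.trans ?_
  have h2 : ∀ x ∈ Finset.range n, subsetProb p (window t n) (fun S => brRun (actOf S) t x < x) ≤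
      2 ^ n * (1 - p / 2) ^ t := by
    intro x hx
    have h3 := subsetExp_pow_actCount (p := p) (1 / 2) (s := 0) (le_refl t) (Finset.mem_range.1 hx)
    have h4 : (1 - p / 2) ^ t = (p * (1 / 2) + (1 - p)) ^ (t - 0) := by
      rw [Nat.sub_zero]; ring
    rw [h4, ← h3, ← subsetExp_const_mul]
    refine subsetExp_mono hp0 hp1 fun S _ => ?_
    split_ifs with h
    · have h5 := min_le_brRun (actOf S) x (Nat.zero_le t)
      have h6 := Finset.mem_range.1 hx
      have h7 : actCount (actOf S) x 0 t ≤ n := by omega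
      calc (1 : ℝ) = 2 ^ n * (1 / 2) ^ n := by rw [← mul_pow]; norm_num
        _ ≤ 2 ^ n * (1 / 2) ^ actCount (actOf S) x 0 t := by
          refine mul_le_mul_of_nonneg_left ?_ (by positivity)
          exact pow_le_pow_of_le_one (by norm_num) (by norm_num) h7
    · positivity
  refine (Finset.sum_le_card_nsmul _ _ _ h2).trans_eq ?_
  rw [Finset.card_range, nsmul_eq_mul]
  ring

theorem unfinishedProb_nonneg {p : ℝ} (hp0 : 0 ≤ p) (hp1 : p ≤ 1) (n t : ℕ) :
    0 ≤ unfinishedProb p n t := subsetProb_nonneg hp0 hp1 _ _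

theorem summable_unfinishedProb {p : ℝ} (hp0 : 0 < p) (hp1 : p ≤ 1) (n : ℕ) :
    Summable (unfinishedProb p n) := by
  refine Summable.of_nonneg_of_le (unfinishedProb_nonneg hp0.le hp1 n)
    (unfinishedProb_le hp0.le hp1 n) ?_
  exact (summable_geometric_of_lt_one (by linarith) (by linarith)).mul_left _

theorem EpTam_eq_tsum {p : ℝ} (hp0 : 0 < p) (hp1 : p ≤ 1) (n : ℕ) :
    EpTam p n = ∑' t, unfinishedProb p n t := by
  unfold EpTam Ungarian.expAbsorb
  simp only [probIn_eq hp0.le hp1]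
  rw [← ENNReal.ofReal_tsum_of_nonneg (unfinishedProb_nonneg hp0.le hp1 n)
    (summable_unfinishedProb hp0 hp1 n), ENNReal.toReal_ofReal]
  exact tsum_nonneg (unfinishedProb_nonneg hp0.le hp1 n)

theorem mul_unfinishedProb_le_EpTam {p : ℝ} (hp0 : 0 < p) (hp1 : p ≤ 1) (n t : ℕ) :
    t * unfinishedProb p n t ≤ EpTam p n := by
  rw [EpTam_eq_tsum hp0 hp1]
  refine le_trans ?_ ((summable_unfinishedProb hp0 hp1 n).sum_le_tsum (Finset.range t)
    fun i _ => unfinishedProb_nonneg hp0.le hp1 n i)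
  refine le_trans (le_of_eq ?_) (Finset.card_nsmul_le_sum _ _ _ fun s hs =>
    unfinishedProb_antitone hp0.le hp1 n (Finset.mem_range.1 hs).le)
  simp

theorem one_le_EpTam {p : ℝ} (hp0 : 0 < p) (hp1 : p ≤ 1) {n : ℕ} (hn : 2 ≤ n) :
    1 ≤ EpTam p n := by
  rw [EpTam_eq_tsum hp0 hp1]
  refine le_trans (le_of_eq ?_) ((summable_unfinishedProb hp0 hp1 n).sum_le_tsum (Finset.range 1)
    fun i _ => unfinishedProb_nonneg hp0.le hp1 n i)
  have h : window 0 n = ∅ := by simp [window]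
  rw [Finset.sum_range_one, unfinishedProb, subsetProb, h, subsetExp_empty,
    if_pos ⟨1, by omega, by simp [brRun]⟩]

/-! ### Late starters -/

theorem actOf_inter {U S : Finset (ℕ × ℕ)} {s c : ℕ} (h : (s, c) ∈ U) :
    actOf (S ∩ U) s c = actOf S s c := by
  simp only [actOf, Finset.mem_inter, h, and_true]

/-- Index `x` is inactive before time `m`, all smaller positive indices are active before
time `e`. -/
def LateStart (e m x : ℕ) (S : Finset (ℕ × ℕ)) : Prop :=
  (∀ s < m, actOf S s x = false) ∧ ∀ c, 0 < c → c < x → ∃ s < e, actOf S s c = true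

theorem subsetProb_inactive {p : ℝ} {c m H n : ℕ} (hm : m ≤ H) (hc : c < n) :
    subsetProb p (window H n) (fun S => ∀ s < m, actOf S s c = false) = (1 - p) ^ m := by
  have h := subsetExp_prod_of_subset (p := p) (column_subset_window (s := 0) hm hc)
    (fun _ => 0) (fun _ => 1)
  simp only [mul_zero, mul_one, zero_add, Finset.prod_const, card_column, Nat.sub_zero] at h
  rw [← h]
  refine subsetExp_congr fun S _ => ?_
  split_ifs with hS
  · refine (Finset.prod_eq_one fun i hi => if_neg fun hi' => ?_).symm
    rw [mem_column] at hi
    have h1 := hS i.1 hi.1.2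
    rw [← hi.2] at h1
    simp [actOf, hi'] at h1
  · push Not at hS
    obtain ⟨s, hs, hS⟩ := hS
    refine (Finset.prod_eq_zero (i := (s, c)) (mem_column.2 ⟨⟨Nat.zero_le _, hs⟩, rfl⟩) ?_).symm
    rw [if_pos (by simpa [actOf] using hS)]

theorem subsetProb_not {ι : Type*} [DecidableEq ι] {p : ℝ} (W : Finset ι) (E : Finset ι → Prop) :
    subsetProb p W (fun S => ¬ E S) = 1 - subsetProb p W E := by
  have h := subsetExp_const (p := p) W 1
  have h1 : subsetExp p W (fun _ => 1) = subsetProb p W (fun S => ¬ E S) + subsetProb p W E := by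
    simp only [subsetProb, ← subsetExp_add]
    exact subsetExp_congr fun S _ => by by_cases h : E S <;> simp [h]
  linarith

theorem subsetProb_active {p : ℝ} {c m H n : ℕ} (hm : m ≤ H) (hc : c < n) :
    subsetProb p (window H n) (fun S => ∃ s < m, actOf S s c = true) = 1 - (1 - p) ^ m := by
  rw [← subsetProb_inactive hm hc, ← subsetProb_not]
  refine subsetProb_congr fun S _ => ?_
  push Not
  simp

theorem subsetProb_forall_active {p : ℝ} {e x H n : ℕ} (he : e ≤ H) (hx : x < n) :
    subsetProb p (window H n)
      (fun S => ∀ c, 0 < c → c < x + 1 → ∃ s < e, actOf S s c = true) =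
      (1 - (1 - p) ^ e) ^ x := by
  induction x with
  | zero =>
    rw [pow_zero, ← subsetExp_const (p := p) (window H n) 1]
    refine subsetExp_congr fun S _ => if_pos fun c h1 h2 => by omega
  | succ x ih =>
    have h1 : subsetProb p (window H n)
        (fun S => ∀ c, 0 < c → c < x + 1 + 1 → ∃ s < e, actOf S s c = true) =
        subsetProb p (window H n) fun S =>
          (∀ c, 0 < c → c < x + 1 → ∃ s < e, actOf S s c = true) ∧
            ∃ s < e, actOf S s (x + 1) = true := by
      refine subsetProb_congr fun S _ => ⟨fun h => ⟨fun c h1 h2 => h c h1 (by omega),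
        h _ (by omega) (by omega)⟩, fun h c h1 h2 => ?_⟩
      rcases (Nat.lt_succ_iff.1 h2).eq_or_lt with rfl | h3
      · exact h.2
      · exact h.1 c h1 h3
    rw [h1, subsetProb_and_of_disjoint (U := window e (x + 1)) (V := column (x + 1) 0 e),
      ih (by omega), subsetProb_active he hx, pow_succ]
    · intro i hi
      rw [mem_window] at *
      omega
    · exact column_subset_window he hx
    · rw [Finset.disjoint_left]
      intro i h1 h2
      rw [mem_window] at h1
      rw [mem_column] at h2
      omega
    · intro S
      refine forall_congr' fun c => forall_congr' fun h1 => forall_congr' fun h2 =>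
        exists_congr fun s => and_congr_right fun hs => ?_
      have : (s, c) ∈ window e (x + 1) := mem_window.2 ⟨hs, h2⟩
      rw [actOf_inter this]
    · intro S
      refine exists_congr fun s => and_congr_right fun hs => ?_
      have : (s, x + 1) ∈ column (x + 1) 0 e := mem_column.2 ⟨⟨Nat.zero_le _, hs⟩, rfl⟩
      rw [actOf_inter this]

theorem subsetProb_lateStart {p : ℝ} {e m x H n : ℕ} (he : e ≤ m) (hm : m ≤ H) (hx0 : 0 < x)
    (hx : x < n) : subsetProb p (window H n) (LateStart e m x) =
      (1 - p) ^ m * (1 - (1 - p) ^ e) ^ (x - 1) := by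
  obtain ⟨x, rfl⟩ : ∃ y, x = y + 1 := ⟨x - 1, by omega⟩
  unfold LateStart
  rw [subsetProb_and_of_disjoint (U := column (x + 1) 0 m) (V := window e (x + 1)),
    subsetProb_inactive hm hx, subsetProb_forall_active (he.trans hm) (by omega),
    Nat.add_sub_cancel]
  · exact column_subset_window hm hx
  · intro i hi
    rw [mem_window] at *
    omega
  · rw [Finset.disjoint_left]
    intro i h1 h2
    rw [mem_window] at h2
    rw [mem_column] at h1
    omega
  · intro S
    refine forall_congr' fun s => forall_congr' fun hs => ?_
    have : (s, x + 1) ∈ column (x + 1) 0 m := mem_column.2 ⟨⟨Nat.zero_le _, hs⟩, rfl⟩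
    rw [actOf_inter this]
  · intro S
    refine forall_congr' fun c => forall_congr' fun h1 => forall_congr' fun h2 =>
        exists_congr fun s => and_congr_right fun hs => ?_
    have : (s, c) ∈ window e (x + 1) := mem_window.2 ⟨hs, h2⟩
    rw [actOf_inter this]

/-- Among the indices in `(y, z]`, index `w` is the last one to be activated. -/
def IsLast (act : ℕ → ℕ → Bool) (y z w : ℕ) : Prop :=
  ∀ z', y < z' → z' ≤ z → z' ≠ w → ∃ s, act s z' = true ∧ ∀ r ≤ s, act r w = false

theorem subsetProb_lateStart_and_strictRec_le {p : ℝ} (hp0 : 0 ≤ p) (hp1 : p ≤ 1)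
    {e m x y z H n : ℕ} (hyz : y < z) (hzx : z < x) (hx : x < n) :
    subsetProb p (window H n) (fun S => LateStart e m x S ∧ StrictRec (actOf S) y z) ≤
      subsetProb p (window H n) (LateStart e m x) / ((z - y : ℕ) : ℝ) := by
  have hpos : (0 : ℝ) < ((z - y : ℕ) : ℝ) := by
    have : 0 < z - y := by omega
    exact_mod_cast this
  rw [le_div_iff₀ hpos]
  have h1 : ∀ w ∈ Finset.Ioc y z, subsetProb p (window H n)
      (fun S => LateStart e m x S ∧ IsLast (actOf S) y z w) = subsetProb p (window H n)
      (fun S => LateStart e m x S ∧ IsLast (actOf S) y z z) := by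
    intro w hw
    rw [Finset.mem_Ioc] at hw
    set σ : Equiv.Perm ℕ := Equiv.swap w z with hσ
    have hσσ : ∀ c, σ (σ c) = c := fun c => by simp [hσ]
    have hσx : σ x = x := Equiv.swap_apply_of_ne_of_ne (by omega) (by omega)
    have hσw : σ z = w := Equiv.swap_apply_right w z
    have hrange : ∀ c, (y < c ∧ c ≤ z ↔ y < σ c ∧ σ c ≤ z) ∧ (0 < c ∧ c < x ↔ 0 < σ c ∧ σ c < x) ∧
        (c < n ↔ σ c < n) := by
      intro c
      simp only [hσ, Equiv.swap_apply_def]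
      split_ifs <;> omega
    have hact : ∀ (S : Finset (ℕ × ℕ)) s c,
        actOf (S.map (Equiv.prodCongr (Equiv.refl ℕ) σ).toEmbedding) s c = actOf S s (σ c) := by
      intro S s c
      simp only [actOf, Finset.mem_map_equiv, Equiv.prodCongr_symm, Equiv.prodCongr_apply]
      rfl
    rw [subsetProb_map_equiv (Equiv.prodCongr (Equiv.refl ℕ) σ)]
    · refine subsetProb_congr fun S _ => and_congr (and_congr ?_ ?_) ?_
      · simp only [hact, hσx]
      · simp only [hact]
        constructor
        · intro h c h1 h2
          have h3 := (hrange c).2.1.1 ⟨h1, h2⟩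
          simpa [hσσ] using h (σ c) h3.1 h3.2
        · intro h c h1 h2
          have h3 := (hrange c).2.1.1 ⟨h1, h2⟩
          exact h (σ c) h3.1 h3.2
      · simp only [IsLast, hact]
        have hw' : σ w = z := Equiv.swap_apply_left w z
        rw [hw']
        constructor
        · intro h c h1 h2 h3
          have h4 := (hrange c).1.1 ⟨h1, h2⟩
          simpa [hσσ] using h (σ c) h4.1 h4.2 fun h5 => h3 (by rw [← hσσ c, h5, hw'])
        · intro h c h1 h2 h3
          have h4 := (hrange c).1.1 ⟨h1, h2⟩
          exact h (σ c) h4.1 h4.2 fun h5 => h3 (by rw [← hσσ c, h5, hσw])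
    · ext ⟨s, c⟩
      rw [Finset.mem_map_equiv, mem_window, mem_window]
      exact and_congr_right fun _ => ((hrange c).2.2).symm
  have h2 := sum_subsetProb_le hp0 hp1 (window H n) (Finset.Ioc y z)
    (fun w S => LateStart e m x S ∧ IsLast (actOf S) y z w) (LateStart e m x)
    (fun w _ S _ h => h.1) (fun S _ w hw w' hw' h h' => by
      by_contra hne
      rw [Finset.mem_Ioc] at hw hw'
      obtain ⟨s, hs, hr⟩ := h.2 w' hw'.1 hw'.2 (Ne.symm hne)
      obtain ⟨s', hs', hr'⟩ := h'.2 w hw.1 hw.2 hne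
      rcases le_total s s' with h3 | h3
      · rw [hr' s h3] at hs; exact absurd hs (by simp)
      · rw [hr s' h3] at hs'; exact absurd hs' (by simp))
  rw [Finset.sum_congr rfl h1, Finset.sum_const, Nat.card_Ioc, nsmul_eq_mul, mul_comm] at h2
  refine le_trans (mul_le_mul_of_nonneg_right (subsetProb_mono hp0 hp1 fun S _ h => ?_)
    hpos.le) h2
  exact ⟨h.1, fun z' h1 h2 h3 => h.2 z' h1 (lt_of_le_of_ne h2 h3)⟩

theorem subsetProb_race_le {p u : ℝ} (hp0 : 0 ≤ p) (hp1 : p ≤ 1) (hu : 1 ≤ u)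
    {c x s d t H n : ℕ} (hc : c < n) (hx : x < n) (hcx : c ≠ x) (ht : t ≤ H) (hst : s + d ≤ t) :
    subsetProb p (window H n) (fun S => ¬ actCount (actOf S) x (s + d) t ≤
      actCount (actOf S) c s t) ≤
      u⁻¹ * (p * u⁻¹ + (1 - p)) ^ d *
        ((p * u + (1 - p)) * (p * u⁻¹ + (1 - p))) ^ (t - (s + d)) := by
  have hu0 : 0 < u := by linarith
  have h1 : subsetExp p (window H n) (fun S => u ^ actCount (actOf S) x (s + d) t *
      u⁻¹ ^ actCount (actOf S) c s t) = (p * u + (1 - p)) ^ (t - (s + d)) *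
        (p * u⁻¹ + (1 - p)) ^ (t - s) := by
    rw [← subsetExp_pow_actCount u ht hx, ← subsetExp_pow_actCount u⁻¹ ht hc]
    refine subsetExp_mul_of_disjoint (U := column x (s + d) t) (V := column c s t)
      (column_subset_window ht hx) (column_subset_window ht hc) ?_ (fun S => ?_) (fun S => ?_)
    · rw [Finset.disjoint_left]
      intro i h1 h2
      rw [mem_column] at h1 h2
      omega
    · rw [pow_actCount, pow_actCount]
      exact Finset.prod_congr rfl fun i hi => by simp only [Finset.mem_inter, hi, and_true]
    · rw [pow_actCount, pow_actCount]
      exact Finset.prod_congr rfl fun i hi => by simp only [Finset.mem_inter, hi, and_true]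
  have h2 : t - s = d + (t - (s + d)) := by omega
  calc _ ≤ subsetExp p (window H n) (fun S => u⁻¹ * (u ^ actCount (actOf S) x (s + d) t *
      u⁻¹ ^ actCount (actOf S) c s t)) := by
        refine subsetExp_mono hp0 hp1 fun S _ => ?_
        split_ifs with h
        · obtain ⟨k, hk⟩ : ∃ k, actCount (actOf S) x (s + d) t =
              actCount (actOf S) c s t + 1 + k := ⟨_, (Nat.add_sub_of_le (by omega)).symm⟩
          have h3 : u⁻¹ * (u ^ actCount (actOf S) x (s + d) t *
              u⁻¹ ^ actCount (actOf S) c s t) = u ^ k := by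
            rw [hk, pow_add, pow_succ, inv_pow]
            field_simp
          rw [h3]
          exact one_le_pow₀ hu
        · positivity
    _ = _ := by
        rw [subsetExp_const_mul, h1, h2, pow_add, mul_pow]
        ring

theorem barrier_congr {act act' : ℕ → ℕ → Bool} {x e : ℕ} {a : ℕ → ℕ} (ha : Monotone a) {i : ℕ}
    (h : ∀ s < e + a i / 2, ∀ d < x, act s d = act' s d) :
    barrier act x e a i = barrier act' x e a i := by
  induction i with
  | zero => rfl
  | succ i ih =>
    have h1 : a i / 2 ≤ a (i + 1) / 2 := Nat.div_le_div_right (ha (Nat.le_add_right i 1))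
    rw [barrier, barrier, ih fun s hs => h s (by omega)]
    congr 1
    funext z
    refine propext (or_congr_right (and_congr_right fun hz => ?_))
    rw [brRun_congr fun s hs d hd => h s hs d (by omega)]

theorem relevant_congr {act act' : ℕ → ℕ → Bool} {x e : ℕ} {a : ℕ → ℕ} (ha : Monotone a) {i c : ℕ}
    (h : ∀ s < e + a i / 2, ∀ d < x, act s d = act' s d) :
    Relevant act x e a i c ↔ Relevant act' x e a i c := by
  unfold Relevant
  rw [barrier_congr ha h]
  refine and_congr_right fun _ => and_congr_right fun hc => ?_
  rw [brRun_congr fun s hs d hd => h s hs d (by omega)]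

theorem card_relevant_le {e m x : ℕ} {S : Finset (ℕ × ℕ)} (hS : LateStart e m x S) (a : ℕ → ℕ)
    (i : ℕ) :
    ((Finset.range x).filter fun c => Relevant (actOf S) x e a i c).card ≤ a (i + 1) + e := by
  set b := barrier (actOf S) x e a i with hb
  set T := (Finset.range x).filter fun c => Relevant (actOf S) x e a i c with hT
  have h1 : T ⊆ Finset.Ioc b (b + a (i + 1)) ∪ T.filter fun c => b + a (i + 1) < c := by
    intro c hc
    have h2 := (Finset.mem_filter.1 hc).2
    rw [Finset.mem_union, Finset.mem_Ioc, Finset.mem_filter]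
    by_cases h3 : b + a (i + 1) < c
    · exact Or.inr ⟨hc, h3⟩
    · exact Or.inl ⟨h2.1, not_lt.1 h3⟩
  refine (Finset.card_le_card h1).trans ((Finset.card_union_le _ _).trans ?_)
  rw [Nat.card_Ioc, Nat.add_sub_cancel_left]
  refine Nat.add_le_add_left (card_strictRec_le (act := actOf S) (y := b + a (i + 1)) _ ?_) _
  intro z hz
  obtain ⟨hz1, hz2⟩ := Finset.mem_filter.1 hz
  have h2 := (Finset.mem_filter.1 hz1).2
  have h3 := hS.2 z (by omega) h2.2.1
  exact ⟨hz2, h3, strictRec_of_brRun_le h3 (Nat.le_add_right _ _) h2.2.2⟩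

/-- Bound for the probability that index `x` catches up a relevant index in a stage that lasts
from time `a` to time `b`, relative to the end of the initial phase of length `e`; `u` is the
parameter of the exponential Markov inequality. -/
def raceBound (p u : ℝ) (e a b : ℕ) : ℝ :=
  ((b + e : ℕ) : ℝ) * ((b - a : ℕ) : ℝ) * (u⁻¹ * (p * u⁻¹ + (1 - p)) ^ (a - a / 2) *
    ((p * u + (1 - p)) * (p * u⁻¹ + (1 - p))) ^ b)

theorem subsetProb_lateStart_and_race_le {p u : ℝ} (hp0 : 0 ≤ p) (hp1 : p ≤ 1) (hu : 1 ≤ u)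
    {e x H n : ℕ} {a : ℕ → ℕ} (ha : Monotone a) (hx : x < n) {i : ℕ} (hH : e + a (i + 1) ≤ H) :
    subsetProb p (window H n) (fun S => LateStart e (e + a 0) x S ∧
      ∃ c, Relevant (actOf S) x e a i c ∧ ∃ t, e + a i ≤ t ∧ t < e + a (i + 1) ∧
        ¬ actCount (actOf S) x (e + a i) t ≤ actCount (actOf S) c (e + a i / 2) t) ≤
      subsetProb p (window H n) (LateStart e (e + a 0) x) * raceBound p u e (a i) (a (i + 1)) := by
  have hu0 : 0 < u := by linarith
  have hq : 0 ≤ 1 - p := by linarith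
  have hai : a 0 ≤ a i := ha (Nat.zero_le i)
  set W := window H n with hW
  set φ := u⁻¹ * (p * u⁻¹ + (1 - p)) ^ (a i - a i / 2) *
    ((p * u + (1 - p)) * (p * u⁻¹ + (1 - p))) ^ (a (i + 1)) with hφ
  have hbase : 1 ≤ (p * u + (1 - p)) * (p * u⁻¹ + (1 - p)) := by
    have h1 : (p * u + (1 - p)) * (p * u⁻¹ + (1 - p)) =
        1 + p * (1 - p) * ((u - 1) ^ 2 * u⁻¹) := by field_simp; ring
    rw [h1]
    have : 0 ≤ p * (1 - p) * ((u - 1) ^ 2 * u⁻¹) := by positivity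
    linarith
  have hrace : ∀ c < x, ∀ t, e + a i ≤ t → t < e + a (i + 1) →
      subsetProb p W (fun S => ¬ actCount (actOf S) x (e + a i) t ≤
        actCount (actOf S) c (e + a i / 2) t) ≤ φ := by
    intro c hc t ht1 ht2
    have h1 : e + a i = (e + a i / 2) + (a i - a i / 2) := by omega
    have h2 := subsetProb_race_le hp0 hp1 hu (c := c) (x := x) (s := e + a i / 2)
      (d := a i - a i / 2) (t := t) (H := H) (n := n) (by omega) hx hc.ne (by omega) (by omega)
    rw [← h1] at h2
    refine h2.trans (mul_le_mul_of_nonneg_left (pow_le_pow_right₀ hbase (by omega)) ?_)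
    positivity
  have hle : subsetProb p W (fun S => LateStart e (e + a 0) x S ∧
      ∃ c, Relevant (actOf S) x e a i c ∧ ∃ t, e + a i ≤ t ∧ t < e + a (i + 1) ∧
        ¬ actCount (actOf S) x (e + a i) t ≤ actCount (actOf S) c (e + a i / 2) t) ≤
      ∑ j ∈ Finset.range x ×ˢ Finset.Ico (e + a i) (e + a (i + 1)), subsetProb p W fun S =>
        (LateStart e (e + a 0) x S ∧ Relevant (actOf S) x e a i j.1) ∧
        ¬ actCount (actOf S) x (e + a i) j.2 ≤ actCount (actOf S) j.1 (e + a i / 2) j.2 := by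
    refine le_trans (subsetProb_mono hp0 hp1 fun S _ => ?_) (subsetProb_exists_le hp0 hp1 _ _ _)
    rintro ⟨h1, c, h2, t, h3, h4, h5⟩
    exact ⟨(c, t), Finset.mem_product.2 ⟨Finset.mem_range.2 h2.2.1, Finset.mem_Ico.2 ⟨h3, h4⟩⟩,
      ⟨h1, h2⟩, h5⟩
  have hind : ∀ j ∈ Finset.range x ×ˢ Finset.Ico (e + a i) (e + a (i + 1)),
      (subsetProb p W fun S =>
        (LateStart e (e + a 0) x S ∧ Relevant (actOf S) x e a i j.1) ∧
        ¬ actCount (actOf S) x (e + a i) j.2 ≤ actCount (actOf S) j.1 (e + a i / 2) j.2) ≤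
      subsetProb p W (fun S => LateStart e (e + a 0) x S ∧ Relevant (actOf S) x e a i j.1) *
        φ := by
    rintro ⟨c, t⟩ hj
    simp only [Finset.mem_product, Finset.mem_range, Finset.mem_Ico] at hj
    rw [subsetProb_and_of_disjoint
      (U := window (e + a i / 2) x ∪ column x 0 (e + a 0))
      (V := column c (e + a i / 2) t ∪ column x (e + a i) t)]
    · exact mul_le_mul_of_nonneg_left (hrace c hj.1 t hj.2.1 hj.2.2)
        (subsetProb_nonneg hp0 hp1 _ _)
    · refine Finset.union_subset (fun j hj => ?_) (column_subset_window (by omega) hx)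
      rw [mem_window] at *
      omega
    · exact Finset.union_subset (column_subset_window (by omega) (by omega))
        (column_subset_window (by omega) hx)
    · rw [Finset.disjoint_left]
      intro j h1 h2
      rw [Finset.mem_union, mem_column] at h1 h2
      rw [mem_window] at h1
      rw [mem_column] at h2
      omega
    · intro S
      have hin : ∀ s < e + a i / 2, ∀ d < x,
          (s, d) ∈ window (e + a i / 2) x ∪ column x 0 (e + a 0) := fun s hs d hd =>
        Finset.mem_union_left _ (mem_window.2 ⟨hs, hd⟩)
      refine and_congr (and_congr ?_ ?_) ?_
      · refine forall_congr' fun s => forall_congr' fun hs => ?_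
        rw [actOf_inter (Finset.mem_union_right _ (mem_column.2 ⟨⟨Nat.zero_le _, hs⟩, rfl⟩))]
      · refine forall_congr' fun d => forall_congr' fun h1 => forall_congr' fun h2 =>
          exists_congr fun s => and_congr_right fun hs => ?_
        rw [actOf_inter (hin s (by omega) d h2)]
      · exact (relevant_congr ha fun s hs d hd => actOf_inter (hin s hs d hd)).symm
    · intro S
      have h1 : actCount (actOf (S ∩ (column c (e + a i / 2) t ∪ column x (e + a i) t))) x
          (e + a i) t = actCount (actOf S) x (e + a i) t := by
        unfold actCount
        congr 1
        refine Finset.filter_congr fun s hs => ?_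
        rw [actOf_inter (Finset.mem_union_right _ (mem_column.2 ⟨Finset.mem_Ico.1 hs, rfl⟩))]
      have h2 : actCount (actOf (S ∩ (column c (e + a i / 2) t ∪ column x (e + a i) t))) c
          (e + a i / 2) t = actCount (actOf S) c (e + a i / 2) t := by
        unfold actCount
        congr 1
        refine Finset.filter_congr fun s hs => ?_
        rw [actOf_inter (Finset.mem_union_left _ (mem_column.2 ⟨Finset.mem_Ico.1 hs, rfl⟩))]
      rw [h1, h2]
  have hφ0 : 0 ≤ φ := by positivity
  have hsum : ∑ c ∈ Finset.range x, subsetProb p W (fun S => LateStart e (e + a 0) x S ∧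
      Relevant (actOf S) x e a i c) ≤
      ((a (i + 1) + e : ℕ) : ℝ) * subsetProb p W (LateStart e (e + a 0) x) := by
    simp only [subsetProb]
    rw [← subsetExp_sum, ← subsetExp_const_mul]
    refine subsetExp_mono hp0 hp1 fun S _ => ?_
    by_cases hS : LateStart e (e + a 0) x S
    · simp only [hS, true_and, if_true, mul_one, Finset.sum_boole]
      exact_mod_cast card_relevant_le hS a i
    · simp [hS]
  calc _ ≤ _ := hle
    _ ≤ _ := Finset.sum_le_sum hind
    _ = (∑ c ∈ Finset.range x, subsetProb p W (fun S => LateStart e (e + a 0) x S ∧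
      Relevant (actOf S) x e a i c)) * (((a (i + 1) - a i : ℕ) : ℝ) * φ) := by
        rw [Finset.sum_product, Finset.sum_mul]
        refine Finset.sum_congr rfl fun c _ => ?_
        simp only [Finset.sum_const, Nat.card_Ico, nsmul_eq_mul, Nat.add_sub_add_left]
        ring
    _ ≤ _ := mul_le_mul_of_nonneg_right hsum (by positivity)
    _ = _ := by
        rw [raceBound]
        ring

/-- A late starter is likely to be unsettled for a long time. -/
theorem le_subsetProb_lateStart_and_unsettled {p : ℝ} (hp0 : 0 ≤ p) (hp1 : p ≤ 1)
    {e x k ρ n H : ℕ} {a R : ℕ → ℕ} {u : ℕ → ℝ} (hu : ∀ i, 1 ≤ u i) (ha : Monotone a)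
    (haρ : ∀ i, a i ≤ ρ) (hR0 : R 0 ≤ x) (hRρ : ∀ i ≤ k, ρ < R i)
    (hRmono : ∀ i < k, R (i + 1) + ρ ≤ R i) (hx : x < n) (hH : H = e + a (k + 1)) :
    subsetProb p (window H n) (LateStart e (e + a 0) x) *
      (1 - ∑ i ∈ Finset.range k, (R (i + 1) : ℝ) / ((R i - ρ - R (i + 1) + 1 : ℕ) : ℝ) -
        ∑ i ∈ Finset.range (k + 1), raceBound p (u i) e (a i) (a (i + 1))) ≤
      subsetProb p (window H n) fun S => LateStart e (e + a 0) x S ∧ brRun (actOf S) H x < x := by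
  set W := window H n with hW
  set P := subsetProb p W (LateStart e (e + a 0) x) with hP
  have hP0 : 0 ≤ P := subsetProb_nonneg hp0 hp1 _ _
  have hRx : ∀ i ≤ k, R i ≤ x := by
    intro i
    induction i with
    | zero => exact fun _ => hR0
    | succ i ih => intro hi; have := hRmono i hi; have := ih (by omega); omega
  let Room : ℕ → Finset (ℕ × ℕ) → Prop := fun i S => LateStart e (e + a 0) x S ∧
    ∃ z, x - R (i + 1) < z ∧ z < x ∧ StrictRec (actOf S) (x - R i + ρ) z
  let Race : ℕ → Finset (ℕ × ℕ) → Prop := fun i S => LateStart e (e + a 0) x S ∧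
      ∃ c, Relevant (actOf S) x e a i c ∧ ∃ t, e + a i ≤ t ∧ t < e + a (i + 1) ∧
        ¬ actCount (actOf S) x (e + a i) t ≤ actCount (actOf S) c (e + a i / 2) t
  have hcover : P ≤ subsetProb p W (fun S => LateStart e (e + a 0) x S ∧
      brRun (actOf S) H x < x) + (subsetProb p W (fun S => ∃ i ∈ Finset.range k, Room i S) +
        subsetProb p W (fun S => ∃ i ∈ Finset.range (k + 1), Race i S)) := by
    refine le_trans (subsetProb_mono hp0 hp1 fun S _ hS => ?_) ((subsetProb_or_le hp0 hp1 W _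
      fun S => (∃ i ∈ Finset.range k, Room i S) ∨ ∃ i ∈ Finset.range (k + 1), Race i S).trans
      (by gcongr; exact subsetProb_or_le hp0 hp1 W _ _))
    by_contra hcon
    rw [not_or, not_or] at hcon
    obtain ⟨h1, h2, h3⟩ := hcon
    refine h1 ⟨hS, ?_⟩
    rw [hH]
    refine brRun_lt_of_stages ha haρ hS.1 hS.2 hR0 hRρ (fun i hi z hz1 hz2 hz3 => ?_)
      (fun i hi c hc t ht1 ht2 => ?_) hRmono
    · exact h2 ⟨i, Finset.mem_range.2 hi, hS, z, hz1, hz2, hz3⟩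
    · by_contra hcon
      exact h3 ⟨i, Finset.mem_range.2 hi, hS, c, hc, t, ht1, ht2, hcon⟩
  have hroom : ∀ i ∈ Finset.range k, subsetProb p W (Room i) ≤
      P * ((R (i + 1) : ℝ) / ((R i - ρ - R (i + 1) + 1 : ℕ) : ℝ)) := by
    intro i hi
    have hi := Finset.mem_range.1 hi
    have h1 := hRmono i hi
    have h2 := hRx i hi.le
    have h3 : subsetProb p W (Room i) ≤ ∑ z ∈ Finset.Ioo (x - R (i + 1)) x,
        subsetProb p W fun S => LateStart e (e + a 0) x S ∧
          StrictRec (actOf S) (x - R i + ρ) z := by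
      refine le_trans (subsetProb_mono hp0 hp1 fun S _ => ?_) (subsetProb_exists_le hp0 hp1 _ _ _)
      rintro ⟨hS, z, hz1, hz2, hz3⟩
      exact ⟨z, Finset.mem_Ioo.2 ⟨hz1, hz2⟩, hS, hz3⟩
    have h4 : ∀ z ∈ Finset.Ioo (x - R (i + 1)) x, (subsetProb p W fun S =>
        LateStart e (e + a 0) x S ∧ StrictRec (actOf S) (x - R i + ρ) z) ≤
        P / ((R i - ρ - R (i + 1) + 1 : ℕ) : ℝ) := by
      intro z hz
      rw [Finset.mem_Ioo] at hz
      refine (subsetProb_lateStart_and_strictRec_le hp0 hp1 (by omega) hz.2 hx).trans ?_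
      refine div_le_div_of_nonneg_left hP0 (by positivity) ?_
      have : R i - ρ - R (i + 1) + 1 ≤ z - (x - R i + ρ) := by omega
      exact_mod_cast this
    refine h3.trans ((Finset.sum_le_card_nsmul _ _ _ h4).trans ?_)
    rw [nsmul_eq_mul, Nat.card_Ioo]
    have h5 : ((x - (x - R (i + 1)) - 1 : ℕ) : ℝ) ≤ R (i + 1) := by
      have : x - (x - R (i + 1)) - 1 ≤ R (i + 1) := by omega
      exact_mod_cast this
    calc _ ≤ (R (i + 1) : ℝ) * (P / ((R i - ρ - R (i + 1) + 1 : ℕ) : ℝ)) :=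
          mul_le_mul_of_nonneg_right h5 (by positivity)
      _ = _ := by ring
  have hrace : ∀ i ∈ Finset.range (k + 1), subsetProb p W (Race i) ≤
      P * raceBound p (u i) e (a i) (a (i + 1)) := by
    intro i hi
    have hi := Finset.mem_range.1 hi
    refine subsetProb_lateStart_and_race_le hp0 hp1 (hu i) ha hx ?_
    have : a (i + 1) ≤ a (k + 1) := ha (by omega)
    omega
  have h1 := (subsetProb_exists_le hp0 hp1 W (Finset.range k) Room).trans (Finset.sum_le_sum hroom)
  have h2 := (subsetProb_exists_le hp0 hp1 W (Finset.range (k + 1)) Race).trans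
    (Finset.sum_le_sum hrace)
  rw [← Finset.mul_sum] at h1 h2
  rw [mul_sub, mul_sub, mul_one]
  linarith

theorem le_unfinishedProb {p : ℝ} (hp0 : 0 ≤ p) (hp1 : p ≤ 1) {e k ρ n : ℕ} {a R : ℕ → ℕ}
    {u : ℕ → ℝ} (hu : ∀ i, 1 ≤ u i) (ha : Monotone a) (haρ : ∀ i, a i ≤ ρ)
    (hRρ : ∀ i ≤ k, ρ < R i) (hRmono : ∀ i < k, R (i + 1) + ρ ≤ R i) {X : Finset ℕ}
    (hX : ∀ x ∈ X, R 0 ≤ x ∧ x < n) :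
    ∑ x ∈ X, (1 - p) ^ (e + a 0) * (1 - (1 - p) ^ e) ^ (x - 1) *
      (1 - ∑ i ∈ Finset.range k, (R (i + 1) : ℝ) / ((R i - ρ - R (i + 1) + 1 : ℕ) : ℝ) -
        ∑ i ∈ Finset.range (k + 1), raceBound p (u i) e (a i) (a (i + 1))) ≤
      unfinishedProb p n (e + a (k + 1)) := by
  have ha0 : a 0 ≤ a (k + 1) := ha (Nat.zero_le _)
  have hpos : ∀ x ∈ X, 0 < x := fun x hx => by
    have := hRρ 0 (Nat.zero_le _); have := (hX x hx).1; omega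
  refine (Finset.sum_le_sum fun x hx => ?_).trans (sum_subsetProb_le hp0 hp1
    (window (e + a (k + 1)) n) X (fun x S => LateStart e (e + a 0) x S ∧
      brRun (actOf S) (e + a (k + 1)) x < x) _ (fun x hx S _ h => ⟨x, (hX x hx).2, h.2⟩)
      (fun S _ x hx y hy hx' hy' => ?_))
  · rw [← subsetProb_lateStart (Nat.le_add_right e (a 0)) (Nat.add_le_add_left ha0 e) (hpos x hx)
      (hX x hx).2]
    exact le_subsetProb_lateStart_and_unsettled hp0 hp1 hu ha haρ (hX x hx).1 hRρ hRmono
      (hX x hx).2 rfl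
  · by_contra hne
    rcases lt_or_gt_of_ne hne with h | h
    · obtain ⟨s, hs, hs'⟩ := hy'.1.2 x (hpos x hx) h
      rw [hx'.1.1 s (by omega)] at hs'
      exact absurd hs' (by simp)
    · obtain ⟨s, hs, hs'⟩ := hx'.1.2 y (hpos y hy) h
      rw [hy'.1.1 s (by omega)] at hs'
      exact absurd hs' (by simp)

/-! ### Choice of scales -/

theorem room_ratio_le {k ρ i : ℕ} (hk : 1 ≤ k) (hρ : 1 ≤ ρ) (hi : i < k) :
    ((2 * ρ * (8 * k) ^ (k - (i + 1)) : ℕ) : ℝ) / ((2 * ρ * (8 * k) ^ (k - i) - ρ -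
      2 * ρ * (8 * k) ^ (k - (i + 1)) + 1 : ℕ) : ℝ) ≤ 1 / (4 * k) := by
  obtain ⟨j, rfl⟩ : ∃ j, k = i + 1 + j := ⟨k - (i + 1), by omega⟩
  set K := i + 1 + j
  have e1 : K - (i + 1) = j := by omega
  have e2 : K - i = j + 1 := by omega
  rw [e1, e2, pow_succ]
  have hB : 1 ≤ (8 * K) ^ j := Nat.one_le_pow _ _ (by omega)
  set B := (8 * K) ^ j
  have h1 : 1 ≤ ρ * B := Nat.mul_le_mul hρ hB
  have h2 : ρ ≤ ρ * B := Nat.le_mul_of_pos_right _ hB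
  have h3 : 2 * ρ * (B * (8 * K)) = 16 * K * (ρ * B) := by ring
  have h4 : 2 * ρ * B = 2 * (ρ * B) := by ring
  rw [h3, h4]
  have h5 : ρ * B ≤ K * (ρ * B) := Nat.le_mul_of_pos_left _ (by omega)
  have h6 : 8 * K * (ρ * B) ≤ 16 * K * (ρ * B) - ρ - 2 * (ρ * B) + 1 := by
    have : 16 * K * (ρ * B) = 16 * (K * (ρ * B)) := by ring
    have : 8 * K * (ρ * B) = 8 * (K * (ρ * B)) := by ring
    omega
  have hK : (1 : ℝ) ≤ K := by exact_mod_cast hk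
  have h1' : (1 : ℝ) ≤ (ρ * B : ℕ) := by exact_mod_cast h1
  have h6' : 8 * (K : ℝ) * (ρ * B : ℕ) ≤
      ((16 * K * (ρ * B) - ρ - 2 * (ρ * B) + 1 : ℕ) : ℝ) := by exact_mod_cast h6
  rw [div_le_div_iff₀ (by nlinarith) (by linarith)]
  push_cast at h6' h1' ⊢
  nlinarith

theorem le_EpTam_of_race_le {p : ℝ} (hp0 : 0 < p) (hp1 : p ≤ 1) {e k ρ m n : ℕ} {a : ℕ → ℕ}
    {u : ℕ → ℝ} (hk : 1 ≤ k) (hρ : 1 ≤ ρ) (hu : ∀ i, 1 ≤ u i) (ha : Monotone a)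
    (haρ : ∀ i, a i ≤ ρ) (hak : a (k + 1) = ρ) (hmn : m ≤ n) (hm : 4 * ρ * (8 * k) ^ k ≤ m)
    (hme : m * (1 - p) ^ e ≤ 1 / 2)
    (hrace : ∑ i ∈ Finset.range (k + 1), raceBound p (u i) e (a i) (a (i + 1)) ≤ 1 / 4) :
    ρ * (m * (1 - p) ^ (e + a 0) / 8) ≤ EpTam p n := by
  have hq0 : 0 ≤ 1 - p := by linarith
  have hroom : ∑ i ∈ Finset.range k, ((2 * ρ * (8 * k) ^ (k - (i + 1)) : ℕ) : ℝ) /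
      ((2 * ρ * (8 * k) ^ (k - i) - ρ - 2 * ρ * (8 * k) ^ (k - (i + 1)) + 1 : ℕ) : ℝ) ≤ 1 / 4 := by
    refine (Finset.sum_le_card_nsmul _ _ _ fun i hi =>
      room_ratio_le hk hρ (Finset.mem_range.1 hi)).trans (le_of_eq ?_)
    have : (0 : ℝ) < k := by exact_mod_cast hk
    rw [Finset.card_range, nsmul_eq_mul]
    field_simp
  have h8k : 1 ≤ 8 * k := by omega
  have hpow1 : ∀ i, 1 ≤ (8 * k) ^ i := fun i => Nat.one_le_pow _ _ h8k
  have key := le_unfinishedProb (n := n) (e := e) (k := k) (R := fun i => 2 * ρ * (8 * k) ^ (k - i))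
    hp0.le hp1 hu ha haρ
    (fun i _ => by
      have := Nat.mul_le_mul_left ρ (hpow1 (k - i))
      show ρ < 2 * ρ * (8 * k) ^ (k - i)
      rw [mul_assoc]; omega)
    (fun i hi => by
      show 2 * ρ * (8 * k) ^ (k - (i + 1)) + ρ ≤ 2 * ρ * (8 * k) ^ (k - i)
      rw [show k - i = k - (i + 1) + 1 by omega, pow_succ]
      have h1 := Nat.mul_le_mul_left ρ (hpow1 (k - (i + 1)))
      have h2 : 2 * ρ * (8 * k) ^ (k - (i + 1)) * 2 ≤
        2 * ρ * (8 * k) ^ (k - (i + 1)) * (8 * k) := Nat.mul_le_mul_left _ (by omega)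
      have h3 : 2 * ρ * (8 * k) ^ (k - (i + 1)) = 2 * (ρ * (8 * k) ^ (k - (i + 1))) := by ring
      rw [← mul_assoc]
      omega)
    (X := Finset.Ico (m / 2) m)
    (fun x hx => by
      rw [Finset.mem_Ico] at hx
      refine ⟨?_, by omega⟩
      show 2 * ρ * (8 * k) ^ (k - 0) ≤ x
      have : 4 * ρ * (8 * k) ^ k = 2 * (2 * ρ * (8 * k) ^ k) := by ring
      rw [Nat.sub_zero]
      omega)
  rw [hak] at key
  have hqe0 : 0 ≤ (1 - p) ^ e := pow_nonneg hq0 _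
  have hm1 : (1 : ℝ) ≤ m := by
    have : 1 ≤ m := le_trans (by have := Nat.mul_le_mul hρ (hpow1 k); rw [mul_assoc]; omega) hm
    exact_mod_cast this
  have hqe1 : (1 - p) ^ e ≤ 1 := pow_le_one₀ hq0 (by linarith)
  have hterm : ∀ x ∈ Finset.Ico (m / 2) m, (1 - p) ^ (e + a 0) * (1 / 4) ≤
      (1 - p) ^ (e + a 0) * (1 - (1 - p) ^ e) ^ (x - 1) *
      (1 - ∑ i ∈ Finset.range k, ((2 * ρ * (8 * k) ^ (k - (i + 1)) : ℕ) : ℝ) /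
      ((2 * ρ * (8 * k) ^ (k - i) - ρ - 2 * ρ * (8 * k) ^ (k - (i + 1)) + 1 : ℕ) : ℝ) -
        ∑ i ∈ Finset.range (k + 1), raceBound p (u i) e (a i) (a (i + 1))) := by
    intro x hx
    rw [Finset.mem_Ico] at hx
    have h1 : (1 : ℝ) / 2 ≤ (1 - (1 - p) ^ e) ^ (x - 1) := by
      have hb := one_add_mul_le_pow (a := -(1 - p) ^ e) (by linarith) (x - 1)
      have hx' : ((x - 1 : ℕ) : ℝ) ≤ m := by
        have : x - 1 ≤ m := by omega
        exact_mod_cast this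
      have := mul_le_mul_of_nonneg_right hx' hqe0
      rw [← sub_eq_add_neg] at hb
      linarith
    rw [mul_assoc]
    refine mul_le_mul_of_nonneg_left ?_ (pow_nonneg hq0 _)
    nlinarith
  have hsum := (Finset.card_nsmul_le_sum _ _ _ hterm).trans key
  have hcard : (m : ℝ) / 2 ≤ (Finset.Ico (m / 2) m).card := by
    rw [Nat.card_Ico]
    have : m ≤ 2 * (m - m / 2) := by omega
    have : (m : ℝ) ≤ 2 * (m - m / 2 : ℕ) := by exact_mod_cast this
    linarith
  rw [nsmul_eq_mul] at hsum
  have hqa : 0 ≤ (1 - p) ^ (e + a 0) := pow_nonneg hq0 _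
  have h1 : m * (1 - p) ^ (e + a 0) / 8 ≤ unfinishedProb p n (e + ρ) :=
    le_trans (by nlinarith) hsum
  have h2 := mul_unfinishedProb_le_EpTam hp0 hp1 n (e + ρ)
  have h3 := unfinishedProb_nonneg hp0.le hp1 n (e + ρ)
  push_cast at h2
  have : (0 : ℝ) ≤ e := Nat.cast_nonneg _
  have : (0 : ℝ) ≤ ρ := Nat.cast_nonneg _
  nlinarith

theorem raceBound_self (p u : ℝ) (e a : ℕ) : raceBound p u e a a = 0 := by
  simp [raceBound]

theorem raceBound_exp_le {p : ℝ} (hp0 : 0 ≤ p) (hp1 : p ≤ 1) {y : ℝ} (hy : 1 ≤ y) (e ρ : ℕ) :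
    raceBound p (Real.exp (y ^ 2)⁻¹) e (min ρ ⌊y ^ 3⌋₊) (min ρ ⌊y ^ 4⌋₊) ≤
      2 * ((y ^ 4 + e) * y ^ 4 * Real.exp (-(p * y / 8))) := by
  have hy0 : 0 < y := by linarith
  have h34 : ⌊y ^ 3⌋₊ ≤ ⌊y ^ 4⌋₊ := Nat.floor_le_floor (pow_le_pow_right₀ hy (by norm_num))
  have hRHS : 0 ≤ 2 * ((y ^ 4 + e) * y ^ 4 * Real.exp (-(p * y / 8))) := by positivity
  by_cases hρ : ρ ≤ ⌊y ^ 3⌋₊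
  · rw [min_eq_left hρ, min_eq_left (hρ.trans h34), raceBound_self]
    exact hRHS
  rw [min_eq_right (not_le.1 hρ).le]
  set a := ⌊y ^ 3⌋₊
  set b := min ρ ⌊y ^ 4⌋₊
  have hb : (b : ℝ) ≤ y ^ 4 := le_trans (by exact_mod_cast min_le_right _ _)
    (Nat.floor_le (by positivity))
  have hba : ((b - a : ℕ) : ℝ) ≤ y ^ 4 := le_trans (by exact_mod_cast Nat.sub_le _ _) hb
  set θ := (y ^ 2)⁻¹ with hθ
  have hθ0 : 0 < θ := by positivity
  have hθ1 : θ ≤ 1 := inv_le_one_of_one_le₀ (one_le_pow₀ hy)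
  have hexp : (Real.exp θ)⁻¹ = Real.exp (-θ) := (Real.exp_neg θ).symm
  have habs1 := Real.abs_exp_sub_one_sub_id_le (x := θ) (by rw [abs_of_pos hθ0]; exact hθ1)
  have habs2 := Real.abs_exp_sub_one_sub_id_le (x := -θ)
    (by rw [abs_neg, abs_of_pos hθ0]; exact hθ1)
  rw [abs_le] at habs1 habs2
  have hneg : Real.exp (-θ) ≤ 1 - θ / 2 := by
    have h1 := Real.exp_bound_div_one_sub_of_interval hθ0.le
    have h2 : 1 + θ ≤ Real.exp θ := by linarith [Real.add_one_le_exp θ]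
    rw [← hexp]
    refine (inv_anti₀ (by linarith) h2).trans ?_
    rw [inv_eq_one_div, div_le_iff₀ (by linarith)]
    nlinarith
  have hpu : p * Real.exp (-θ) + (1 - p) ≤ Real.exp (-(p * θ / 2)) := by
    have := Real.add_one_le_exp (-(p * θ / 2))
    nlinarith
  have hpu0 : 0 ≤ p * Real.exp (-θ) + (1 - p) := by
    have := mul_nonneg hp0 (Real.exp_pos (-θ)).le
    linarith
  have hprod : (p * Real.exp θ + (1 - p)) * (p * Real.exp (-θ) + (1 - p)) ≤
      Real.exp (θ ^ 2 / 2) := by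
    have h1 : Real.exp θ * Real.exp (-θ) = 1 := by rw [← Real.exp_add]; simp
    have h2 : (p * Real.exp θ + (1 - p)) * (p * Real.exp (-θ) + (1 - p)) =
      1 + p * (1 - p) * (Real.exp θ + Real.exp (-θ) - 2) + p ^ 2 * (Real.exp θ * Real.exp (-θ) - 1)
      := by ring
    rw [h2, h1]
    have h3 : p * (1 - p) ≤ 1 / 4 := by nlinarith [sq_nonneg (p - 1 / 2)]
    have h4 : Real.exp θ + Real.exp (-θ) - 2 ≤ 2 * θ ^ 2 := by nlinarith
    have h5 := Real.add_one_le_exp (θ ^ 2 / 2)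
    have h6 : 0 ≤ p * (1 - p) := mul_nonneg hp0 (by linarith)
    have h7 : p * (1 - p) * (Real.exp θ + Real.exp (-θ) - 2) ≤ p * (1 - p) * (2 * θ ^ 2) :=
      mul_le_mul_of_nonneg_left h4 h6
    nlinarith [sq_nonneg θ]
  have hprod0 : 0 ≤ (p * Real.exp θ + (1 - p)) * (p * Real.exp (-θ) + (1 - p)) :=
    mul_nonneg (by have := mul_nonneg hp0 (Real.exp_pos θ).le; linarith) hpu0
  have hP1 : ((p * Real.exp θ + (1 - p)) * (p * Real.exp (-θ) + (1 - p))) ^ b ≤ 2 := by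
    calc _ ≤ Real.exp (θ ^ 2 / 2) ^ b := pow_le_pow_left₀ hprod0 hprod _
      _ = Real.exp (b * (θ ^ 2 / 2)) := (Real.exp_nat_mul _ _).symm
      _ ≤ Real.exp (1 / 2) := by
        refine Real.exp_le_exp.2 ?_
        have : θ ^ 2 * y ^ 4 = 1 := by rw [hθ]; field_simp
        nlinarith [sq_nonneg θ]
      _ ≤ 2 := by
        have := Real.exp_bound_div_one_sub_of_interval (x := 1 / 2) (by norm_num) (by norm_num)
        linarith
  have haθ : y / 4 ≤ ((a - a / 2 : ℕ) : ℝ) * θ := by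
    have h1 : (a : ℝ) ≤ 2 * ((a - a / 2 : ℕ) : ℝ) := by
      have : a ≤ 2 * (a - a / 2) := by omega
      exact_mod_cast this
    have h2 : y ^ 3 < a + 1 := Nat.lt_floor_add_one _
    have h3 : (1 : ℝ) ≤ a := by
      have : 1 ≤ a := Nat.le_floor (by simpa using one_le_pow₀ hy)
      exact_mod_cast this
    have h4 : y ^ 3 ≤ 4 * ((a - a / 2 : ℕ) : ℝ) := by linarith
    have h5 : y ^ 3 * θ = y := by rw [hθ]; field_simp
    nlinarith
  have hP2 : (p * Real.exp (-θ) + (1 - p)) ^ (a - a / 2) ≤ Real.exp (-(p * y / 8)) := by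
    calc _ ≤ Real.exp (-(p * θ / 2)) ^ (a - a / 2) := pow_le_pow_left₀ hpu0 hpu _
      _ = Real.exp (((a - a / 2 : ℕ) : ℝ) * -(p * θ / 2)) := (Real.exp_nat_mul _ _).symm
      _ ≤ _ := by
        refine Real.exp_le_exp.2 ?_
        nlinarith
  have hinv : Real.exp (-θ) ≤ 1 := Real.exp_le_one_iff.2 (by linarith)
  unfold raceBound
  rw [hexp]
  have h1 : Real.exp (-θ) * (p * Real.exp (-θ) + (1 - p)) ^ (a - a / 2) *
      ((p * Real.exp θ + (1 - p)) * (p * Real.exp (-θ) + (1 - p))) ^ b ≤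
      1 * Real.exp (-(p * y / 8)) * 2 := by gcongr
  have h2 : ((b + e : ℕ) : ℝ) * ((b - a : ℕ) : ℝ) ≤ (y ^ 4 + e) * y ^ 4 := by
    push_cast
    gcongr
  refine (mul_le_mul h2 h1 (mul_nonneg (mul_nonneg (Real.exp_pos _).le (pow_nonneg hpu0 _))
    (pow_nonneg hprod0 _)) (by positivity)).trans (le_of_eq ?_)
  ring

theorem raceBound_zero_le {p : ℝ} (hp0 : 0 ≤ p) (hp1 : p < 1) {b : ℕ} (hb : 1 ≤ b)
    (hqb : (1 - p) * b ≤ 1) (e : ℕ) :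
    raceBound p ((1 - p) * b)⁻¹ e 0 b ≤ 3 * ((b + e) * b ^ 2 * (1 - p)) := by
  have hb' : (1 : ℝ) ≤ b := by exact_mod_cast hb
  have hq : 0 < 1 - p := by linarith
  unfold raceBound
  rw [inv_inv]
  set v := (1 - p) * b with hv_def
  have hv : 0 < v := by positivity
  have h1 : (p * v⁻¹ + (1 - p)) * (p * v + (1 - p)) ≤ Real.exp (b : ℝ)⁻¹ := by
    have h2 : v⁻¹ * (1 - p) = (b : ℝ)⁻¹ := by rw [hv_def]; field_simp
    have h3 : v⁻¹ * v = 1 := inv_mul_cancel₀ hv.ne'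
    have h4 := Real.add_one_le_exp (b : ℝ)⁻¹
    have h5 : (p * v⁻¹ + (1 - p)) * (p * v + (1 - p)) =
      p ^ 2 * (v⁻¹ * v) + p * (v⁻¹ * (1 - p)) + p * (v * (1 - p)) + (1 - p) ^ 2 := by ring
    rw [h5, h2, h3]
    have h6 : p * (b : ℝ)⁻¹ ≤ 1 * (b : ℝ)⁻¹ :=
      mul_le_mul_of_nonneg_right hp1.le (by positivity)
    have h7 : p * (v * (1 - p)) ≤ p * (1 * (1 - p)) := by gcongr
    have h8 : 0 ≤ p * (1 - p) := mul_nonneg hp0 hq.le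
    linarith [show p ^ 2 * 1 + p * (1 * (1 - p)) + (1 - p) ^ 2 = 1 - p * (1 - p) by ring]
  have h2 : ((p * v⁻¹ + (1 - p)) * (p * v + (1 - p))) ^ b ≤ 3 := by
    calc _ ≤ Real.exp (b : ℝ)⁻¹ ^ b := pow_le_pow_left₀ (by positivity) h1 _
      _ = Real.exp 1 := by
        rw [← Real.exp_nat_mul, mul_inv_cancel₀ (by positivity)]
      _ ≤ 3 := Real.exp_one_lt_d9.le.trans (by norm_num)
  simp only [Nat.sub_zero, Nat.zero_div, pow_zero, mul_one]
  have h3 : v * ((p * v⁻¹ + (1 - p)) * (p * v + (1 - p))) ^ b ≤ v * 3 := by gcongr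
  calc _ ≤ ((b + e : ℕ) : ℝ) * (b : ℝ) * (v * 3) := by gcongr
    _ = _ := by rw [hv_def]; push_cast; ring

theorem le_EpTam_of_scale {p : ℝ} (hp0 : 0 < p) (hp1 : p < 1) {n e k c : ℕ} {y : ℝ} (hn : 2 ≤ n)
    (hk : 1 ≤ k) (hnk : Real.log n ≤ (4 / 3) ^ k) (hne : 1 ≤ n * (1 - p) ^ e)
    (hne' : n * (1 - p) ^ (e + 1) ≤ 1) (hy : Real.exp 1 ≤ y) (hc : c ≤ ⌊y ^ 3⌋₊)
    (h0 : ∀ ρ : ℕ, 1 ≤ ρ → ∃ u, 1 ≤ u ∧ raceBound p u e (min ρ c) (min ρ ⌊y ^ 4⌋₊) ≤ 1 / 8)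
    (hrace : ∀ z, y ≤ z → 2 * ((z ^ 4 + e) * z ^ 4 * Real.exp (-(p * z / 8))) ≤ 1 / (8 * k)) :
    n * (1 - p) ^ (1 + c) / (1024 * (8 * k) ^ k) ≤ EpTam p n := by
  have hq : 0 < 1 - p := by linarith
  have hk' : (1 : ℝ) ≤ k := by exact_mod_cast hk
  have hn0 : (0 : ℝ) < n := by exact_mod_cast (by omega : 0 < n)
  set x := (1 - p) ^ e with hx
  have hx0 : 0 < x := pow_pos hq _
  have hxn : x⁻¹ ≤ n := by rw [inv_le_iff_one_le_mul₀ hx0]; exact hne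
  have hnx : n * (1 - p) ≤ x⁻¹ := by
    rw [← one_div, le_div_iff₀ hx0, mul_assoc, mul_comm (1 - p), hx, ← pow_succ]; exact hne'
  set m := ⌊x⁻¹ / 2⌋₊ with hm_def
  have hmle : (m : ℝ) ≤ x⁻¹ / 2 := Nat.floor_le (by positivity)
  have hmlt : x⁻¹ / 2 < m + 1 := Nat.lt_floor_add_one _
  have hmn : m ≤ n := by
    have : (m : ℝ) ≤ n := by have : 0 < x⁻¹ := by positivity
                             linarith
    exact_mod_cast this
  have hB1 : 1 ≤ (8 * k) ^ k := Nat.one_le_pow _ _ (by omega)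
  set B := (8 * k) ^ k with hB
  have hBr : (8 * (k : ℝ)) ^ k = B := by rw [hB]; push_cast; ring
  rw [hBr]
  have hB1' : (1 : ℝ) ≤ B := by exact_mod_cast hB1
  have hqc1 : (1 - p) ^ c ≤ 1 := pow_le_one₀ hq.le (by linarith)
  have hqc0 : 0 < (1 - p) ^ c := pow_pos hq _
  rw [div_le_iff₀ (by positivity), pow_add, pow_one]
  have hnq : 0 < n * (1 - p) := by positivity
  by_cases hmB : m < 4 * B
  · have h1 : (m : ℝ) + 1 ≤ 4 * B := by exact_mod_cast hmB
    have h2 := one_le_EpTam hp0 hp1.le hn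
    calc n * ((1 - p) * (1 - p) ^ c) = n * (1 - p) * (1 - p) ^ c := by ring
      _ ≤ n * (1 - p) * 1 := by gcongr
      _ ≤ 1 * (1024 * B) := by linarith
      _ ≤ _ := by gcongr
  rw [not_lt] at hmB
  set ρ := m / (4 * B) with hρ_def
  have hρ1 : 1 ≤ ρ := (Nat.one_le_div_iff (by omega)).2 hmB
  have hρm : 4 * ρ * B ≤ m := by
    have := Nat.div_mul_le_self m (4 * B)
    calc 4 * ρ * B = m / (4 * B) * (4 * B) := by rw [hρ_def]; ring
      _ ≤ m := this
  have hmρ : (m : ℝ) ≤ 8 * B * ρ := by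
    have h1 := Nat.lt_mul_div_succ m (show 0 < 4 * B by omega)
    have h2 : 4 * B * (m / (4 * B) + 1) ≤ 8 * B * ρ := by
      rw [← hρ_def]
      have : B ≤ B * ρ := Nat.le_mul_of_pos_right _ hρ1
      have e1 : 4 * B * (ρ + 1) = 4 * (B * ρ) + 4 * B := by ring
      have e2 : 8 * B * ρ = 8 * (B * ρ) := by ring
      omega
    exact_mod_cast h1.le.trans h2
  have hρn : ρ ≤ n := (Nat.div_le_self _ _).trans hmn
  have hm1 : (1 : ℝ) ≤ m := by exact_mod_cast (by omega : 1 ≤ m)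
  have hy0 : 0 < y := (Real.exp_pos 1).trans_le hy
  set s := Real.log y with hs
  have hs1 : 1 ≤ s := (Real.le_log_iff_exp_le hy0).2 hy
  set Y : ℕ → ℝ := fun i => Real.exp (s * (4 / 3) ^ i) with hY
  have hY0 : Y 0 = y := by simp [hY, hs, Real.exp_log hy0]
  have hYmono : Monotone Y := fun i j hij => by
    refine Real.exp_le_exp.2 (mul_le_mul_of_nonneg_left ?_ (by linarith))
    exact pow_le_pow_right₀ (by norm_num) hij
  have hYsucc : ∀ i, Y (i + 1) ^ 3 = Y i ^ 4 := fun i => by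
    simp only [hY, ← Real.exp_nat_mul]
    congr 1
    push_cast
    ring
  have hYy : ∀ i, y ≤ Y i := fun i => hY0 ▸ hYmono (Nat.zero_le i)
  have hy1 : 1 ≤ y := (Real.one_le_exp (by norm_num)).trans hy
  obtain ⟨u₀, hu₀, hrace₀⟩ := h0 ρ hρ1
  set a : ℕ → ℕ := fun i => min ρ (if i = 0 then c else ⌊Y i ^ 3⌋₊) with ha
  have hamono : Monotone a := monotone_nat_of_le_succ fun i => by
    refine min_le_min_left _ ?_
    rw [if_neg (Nat.succ_ne_zero i)]
    have hYi : 0 ≤ Y i := (Real.exp_pos _).le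
    have : ⌊Y i ^ 3⌋₊ ≤ ⌊Y (i + 1) ^ 3⌋₊ :=
      Nat.floor_le_floor (pow_le_pow_left₀ hYi (hYmono (Nat.le_succ i)) 3)
    split_ifs with h
    · subst h
      rw [← hY0] at hc
      exact hc.trans this
    · exact this
  have hak : a (k + 1) = ρ := by
    refine min_eq_left ?_
    rw [if_neg (Nat.succ_ne_zero k)]
    refine hρn.trans (Nat.le_floor ?_)
    simp only [hY]
    rw [← Real.exp_nat_mul, ← Real.log_le_iff_le_exp hn0]
    refine hnk.trans ?_
    have : (0 : ℝ) < (4 / 3) ^ k := by positivity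
    rw [pow_succ]
    push_cast
    nlinarith
  have key := le_EpTam_of_race_le hp0 hp1.le (e := e)
    (u := fun i => if i = 0 then u₀ else Real.exp (Y i ^ 2)⁻¹) hk hρ1
    (fun i => by
      split_ifs
      · exact hu₀
      · exact Real.one_le_exp (by positivity))
    hamono (fun i => min_le_left _ _) hak hmn hρm
    (by
      calc (m : ℝ) * x ≤ x⁻¹ / 2 * x := by gcongr
        _ = 1 / 2 := by field_simp)
    (by
      rw [Finset.sum_range_succ']
      have h1 : ∑ i ∈ Finset.range k, raceBound p
          (if i + 1 = 0 then u₀ else Real.exp (Y (i + 1) ^ 2)⁻¹) e (a (i + 1)) (a (i + 1 + 1)) ≤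
          1 / 8 := by
        refine (Finset.sum_le_card_nsmul _ _ (1 / (8 * k : ℝ)) fun i _ => ?_).trans (le_of_eq ?_)
        · have h2 := raceBound_exp_le hp0.le hp1.le (hy1.trans (hYy (i + 1))) e ρ
          rw [← hYsucc] at h2
          simp only [ha, if_neg (Nat.succ_ne_zero _)]
          refine h2.trans ?_
          rw [hYsucc]
          exact hrace _ (hYy _)
        · rw [Finset.card_range, nsmul_eq_mul]
          field_simp
      have h2 : raceBound p (if 0 = 0 then u₀ else Real.exp (Y 0 ^ 2)⁻¹) e (a 0) (a (0 + 1)) ≤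
          1 / 8 := by
        simp only [ha, if_true, if_neg (Nat.succ_ne_zero _), hYsucc, hY0]
        exact hrace₀
      linarith)
  have ha0 : a 0 ≤ c := min_le_right _ _
  have hpow : x * (1 - p) ^ c ≤ (1 - p) ^ (e + a 0) := by
    rw [pow_add]
    gcongr 1
    exact pow_le_pow_of_le_one hq.le (by linarith) ha0
  have hmx : 1 / 4 ≤ m * x := by
    have : x⁻¹ ≤ 4 * m := by linarith
    have := mul_le_mul_of_nonneg_right this hx0.le
    rw [inv_mul_cancel₀ hx0.ne'] at this
    linarith
  have hρ' : n * (1 - p) ≤ 32 * B * ρ := by linarith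
  calc n * ((1 - p) * (1 - p) ^ c) = n * (1 - p) * (1 - p) ^ c := by ring
    _ ≤ 32 * B * ρ * (1 - p) ^ c := by gcongr
    _ = ρ * (1 / 4 * (1 - p) ^ c / 8) * (1024 * B) := by ring
    _ ≤ ρ * (m * x * (1 - p) ^ c / 8) * (1024 * B) := by gcongr
    _ = ρ * (m * (x * (1 - p) ^ c) / 8) * (1024 * B) := by ring
    _ ≤ ρ * (m * (1 - p) ^ (e + a 0) / 8) * (1024 * B) := by gcongr
    _ ≤ _ := by gcongr

theorem exists_pow_near_inv {p : ℝ} (hp0 : 0 < p) (hp1 : p < 1) {n : ℕ} (hn : 1 ≤ n) :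
    ∃ e : ℕ, 1 ≤ n * (1 - p) ^ e ∧ n * (1 - p) ^ (e + 1) ≤ 1 ∧ p * e ≤ Real.log n := by
  have hn0 : (0 : ℝ) < n := by exact_mod_cast hn
  have hn1 : (1 : ℝ) ≤ n := by exact_mod_cast hn
  obtain ⟨e, he1, he2⟩ := exists_nat_pow_near_of_lt_one (inv_pos.2 hn0)
    (inv_le_one_of_one_le₀ hn1) (by linarith : 0 < 1 - p) (by linarith)
  have h1 : 1 ≤ n * (1 - p) ^ e := by
    calc (1 : ℝ) = n * (n : ℝ)⁻¹ := (mul_inv_cancel₀ hn0.ne').symm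
      _ ≤ _ := by gcongr
  refine ⟨e, h1, ?_, ?_⟩
  · calc n * (1 - p) ^ (e + 1) ≤ n * (n : ℝ)⁻¹ := by gcongr
      _ = 1 := mul_inv_cancel₀ hn0.ne'
  · have h2 : (1 - p) ^ e ≤ Real.exp (-(p * e)) := by
      calc (1 - p) ^ e ≤ Real.exp (-p) ^ e :=
            pow_le_pow_left₀ (by linarith) (Real.one_sub_le_exp_neg p) _
        _ = _ := by rw [← Real.exp_nat_mul]; congr 1; ring
    rw [Real.le_log_iff_exp_le hn0]
    have h3 : 1 ≤ n * Real.exp (-(p * e)) := h1.trans (by gcongr)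
    rw [Real.exp_neg, ← div_eq_mul_inv, le_div_iff₀ (Real.exp_pos _), one_mul] at h3
    exact h3

theorem exists_race_small :
    ∃ L : ℝ, 4 ≤ L ∧ ∀ p : ℝ, 0 < p → p < 1 → ∀ l : ℝ, 1 ≤ l → ∀ e k : ℕ, 1 ≤ k → (k : ℝ) ≤ 5 * l →
      p * e ≤ Real.exp l → ∀ z, L * l / p ^ 2 ≤ z →
      2 * ((z ^ 4 + e) * z ^ 4 * Real.exp (-(p * z / 8))) ≤ 1 / (8 * k) := by
  have hlim : Filter.Tendsto (fun x : ℝ => x ^ 17 * Real.exp (-x)) Filter.atTop (nhds 0) :=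
    Real.tendsto_pow_mul_exp_neg_atTop_nhds_zero 17
  have hev := hlim.eventually (gt_mem_nhds (show (0 : ℝ) < 1 / (160 * 8 ^ 8 * 2 ^ 17) by positivity))
  obtain ⟨T, hT⟩ := Filter.eventually_atTop.1 hev
  refine ⟨8 * max 4 (2 * T), by have := le_max_left 4 (2 * T); linarith, ?_⟩
  intro p hp0 hp1 l hl e k hk hkl he z hz
  set L := max 4 (2 * T)
  have hL4 : 4 ≤ L := le_max_left _ _
  have hLT : 2 * T ≤ L := le_max_right _ _
  obtain ⟨w, rfl⟩ : ∃ w, z = 8 * w / p := ⟨p * z / 8, by field_simp⟩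
  have hw : L * l / p ≤ w := by
    have h1 : L * l / p = (8 * L * l / p ^ 2) * (p / 8) := by field_simp
    have h2 : w = (8 * w / p) * (p / 8) := by field_simp
    rw [h1, h2]
    gcongr
  have hip : 1 ≤ 1 / p := by rw [le_div_iff₀ hp0]; linarith
  have hLl : L * l / p = L * l * (1 / p) := by ring
  have hLl1 : L ≤ L * l := by nlinarith
  have hw1 : L * l ≤ w := le_trans (by rw [hLl]; nlinarith) hw
  have hw2 : 1 / p ≤ w := le_trans (by rw [hLl]; nlinarith) hw
  have hwl : 4 * l ≤ w := by nlinarith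
  have hw0 : 0 < w := by nlinarith
  have hkey : 160 * 8 ^ 8 * w ^ 17 ≤ Real.exp (w / 2) := by
    have h1 := (hT (w / 2) (by nlinarith)).le
    rw [Real.exp_neg, ← div_eq_mul_inv, div_le_div_iff₀ (Real.exp_pos _) (by positivity)] at h1
    calc 160 * 8 ^ 8 * w ^ 17 = (w / 2) ^ 17 * (160 * 8 ^ 8 * 2 ^ 17) := by ring
      _ ≤ _ := by linarith
  have hpw : p * (8 * w / p) / 8 = w := by field_simp
  rw [hpw]
  have hz1 : 1 ≤ 8 * w / p := by rw [le_div_iff₀ hp0]; nlinarith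
  set z := 8 * w / p with hz_def
  have hk0 : (0 : ℝ) < k := by exact_mod_cast hk
  have hel : l ≤ Real.exp l := by linarith [Real.add_one_le_exp l]
  have he1 : (1 : ℝ) + e ≤ 2 * Real.exp l * (1 / p) := by
    have h1 : (e : ℝ) ≤ Real.exp l * (1 / p) := by
      rw [mul_one_div, le_div_iff₀ hp0]; linarith
    nlinarith
  have hz8 : (z ^ 4 + e) * z ^ 4 ≤ (1 + e) * z ^ 8 := by
    have h1 : 1 ≤ z ^ 4 := one_le_pow₀ hz1
    have h2 : (e : ℝ) ≤ e * z ^ 4 := le_mul_of_one_le_right (Nat.cast_nonneg _) h1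
    have h3 : 0 ≤ z ^ 4 := by positivity
    nlinarith
  have hmain : 16 * k * ((z ^ 4 + e) * z ^ 4) ≤ Real.exp w := by
    calc 16 * k * ((z ^ 4 + e) * z ^ 4) ≤ 16 * (5 * Real.exp l) * ((1 + e) * z ^ 8) := by
          gcongr
          linarith
      _ ≤ 16 * (5 * Real.exp l) * (2 * Real.exp l * (1 / p) * z ^ 8) := by gcongr
      _ = 160 * 8 ^ 8 * (w ^ 8 * (1 / p) ^ 9) * (Real.exp l * Real.exp l) := by
          rw [hz_def]; ring
      _ ≤ 160 * 8 ^ 8 * (w ^ 8 * w ^ 9) * Real.exp (w / 2) := by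
          rw [← Real.exp_add]
          gcongr
          linarith
      _ = 160 * 8 ^ 8 * w ^ 17 * Real.exp (w / 2) := by ring
      _ ≤ Real.exp (w / 2) * Real.exp (w / 2) := by gcongr
      _ = Real.exp w := by rw [← Real.exp_add]; congr 1; ring
  rw [le_div_iff₀ (by positivity), Real.exp_neg]
  calc 2 * ((z ^ 4 + e) * z ^ 4 * (Real.exp w)⁻¹) * (8 * k) =
      16 * k * ((z ^ 4 + e) * z ^ 4) * (Real.exp w)⁻¹ := by ring
    _ ≤ Real.exp w * (Real.exp w)⁻¹ := by gcongr
    _ = 1 := mul_inv_cancel₀ (Real.exp_pos _).ne'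

theorem exists_stage_count {l : ℝ} (hl : 1 ≤ l) :
    ∃ k : ℕ, 1 ≤ k ∧ (k : ℝ) ≤ 5 * l ∧ Real.exp l ≤ (4 / 3) ^ k ∧
      1024 * (8 * (k : ℝ)) ^ k ≤ Real.exp (32 * l ^ 2) := by
  have hk1 : 1 ≤ ⌈4 * l⌉₊ := Nat.one_le_ceil_iff.2 (by linarith)
  have hk2 : (⌈4 * l⌉₊ : ℝ) ≤ 5 * l := by
    have := Nat.ceil_lt_add_one (show 0 ≤ 4 * l by linarith)
    linarith
  have hk3 : 4 * l ≤ ⌈4 * l⌉₊ := Nat.le_ceil _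
  generalize ⌈4 * l⌉₊ = k at hk1 hk2 hk3
  refine ⟨k, hk1, hk2, ?_, ?_⟩
  · have h1 : Real.exp (1 / 4) ≤ 4 / 3 := by
      have := Real.exp_bound_div_one_sub_of_interval (x := 1 / 4) (by norm_num) (by norm_num)
      linarith
    calc Real.exp l ≤ Real.exp (k * (1 / 4)) := Real.exp_le_exp.2 (by linarith)
      _ = Real.exp (1 / 4) ^ k := Real.exp_nat_mul _ _
      _ ≤ _ := by gcongr
  · have he : (2.7 : ℝ) ≤ Real.exp 1 := by linarith [Real.exp_one_gt_d9]
    have h1 : 8 * (k : ℝ) ≤ Real.exp (5 * l) := by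
      have h2 : (40 : ℝ) ≤ Real.exp 1 ^ 4 :=
        le_trans (by norm_num) (pow_le_pow_left₀ (by norm_num) he 4)
      have h3 : l ≤ Real.exp l := by linarith [Real.add_one_le_exp l]
      calc 8 * (k : ℝ) ≤ 40 * l := by linarith
        _ ≤ Real.exp 1 ^ 4 * Real.exp l := by gcongr
        _ = Real.exp (4 + l) := by rw [← Real.exp_nat_mul, ← Real.exp_add]; norm_num
        _ ≤ _ := Real.exp_le_exp.2 (by linarith)
    have h4 : (1024 : ℝ) ≤ Real.exp (7 * l ^ 2) := by
      calc (1024 : ℝ) ≤ 2.7 ^ 7 := by norm_num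
        _ ≤ Real.exp 1 ^ 7 := pow_le_pow_left₀ (by norm_num) he 7
        _ = Real.exp 7 := by rw [← Real.exp_nat_mul]; norm_num
        _ ≤ _ := Real.exp_le_exp.2 (by nlinarith)
    calc 1024 * (8 * (k : ℝ)) ^ k ≤ Real.exp (7 * l ^ 2) * Real.exp (5 * l) ^ k := by gcongr
      _ = Real.exp (7 * l ^ 2 + k * (5 * l)) := by rw [← Real.exp_nat_mul, ← Real.exp_add]
      _ ≤ _ := Real.exp_le_exp.2 (by nlinarith)

theorem exists_raceBound_zero_le {p : ℝ} (hp0 : 0 ≤ p) (hp1 : p < 1) {y w : ℝ} (hy1 : 1 ≤ y)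
    (hy16 : (1 - p) * y ^ 16 = 1) (hw : 1 ≤ w) (hwy : 72 * w ≤ y ^ 4) {e ρ : ℕ}
    (he : e ≤ 2 * w) (hρ : 1 ≤ ρ) :
    ∃ u, 1 ≤ u ∧ raceBound p u e (min ρ 0) (min ρ ⌊y ^ 4⌋₊) ≤ 1 / 8 := by
  have hq : 0 < 1 - p := by linarith
  have hb : ((min ρ ⌊y ^ 4⌋₊ : ℕ) : ℝ) ≤ y ^ 4 :=
    le_trans (by exact_mod_cast min_le_right _ _) (Nat.floor_le (by positivity))
  have hb1 : 1 ≤ min ρ ⌊y ^ 4⌋₊ := le_min hρ (Nat.le_floor (by simpa using one_le_pow₀ hy1))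
  set b := min ρ ⌊y ^ 4⌋₊
  have hb1' : (1 : ℝ) ≤ b := by exact_mod_cast hb1
  have hqb : (1 - p) * b ≤ 1 := by
    calc (1 - p) * b ≤ (1 - p) * y ^ 4 := by gcongr
      _ ≤ (1 - p) * y ^ 16 := by gcongr 1; exact pow_le_pow_right₀ hy1 (by norm_num)
      _ = 1 := hy16
  refine ⟨((1 - p) * b)⁻¹, (one_le_inv₀ (by positivity)).2 hqb, ?_⟩
  rw [Nat.min_zero]
  refine (raceBound_zero_le hp0 hp1 hb1 hqb e).trans ?_
  have he4 : (b : ℝ) + e ≤ y ^ 4 * (3 * w) := by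
    have h2 : 1 ≤ y ^ 4 := one_le_pow₀ hy1
    have h4 : (e : ℝ) ≤ y ^ 4 * (2 * w) := he.trans (le_mul_of_one_le_left (by positivity) h2)
    have h5 : y ^ 4 * 1 ≤ y ^ 4 * w := by gcongr
    linarith
  have hY : (1 - p) * y ^ 12 * (72 * w) ≤ 1 := by
    calc (1 - p) * y ^ 12 * (72 * w) ≤ (1 - p) * y ^ 12 * y ^ 4 := by gcongr
      _ = (1 - p) * y ^ 16 := by ring
      _ = 1 := hy16
  calc 3 * ((b + e) * b ^ 2 * (1 - p)) ≤ 3 * (y ^ 4 * (3 * w) * (y ^ 4) ^ 2 * (1 - p)) := by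
        gcongr
    _ = (1 - p) * y ^ 12 * (72 * w) / 8 := by ring
    _ ≤ 1 / 8 := by gcongr

theorem exists_le_EpTam :
    ∃ M A : ℝ, 16 ≤ M ∧ 0 < A ∧ ∀ p : ℝ, 0 < p → p < 1 → ∀ n : ℕ, 16 ≤ n → ∀ l : ℝ, 1 ≤ l →
      Real.log n = Real.exp l →
      (Real.exp (-(M * l)) ≤ 1 - p → n * Real.exp (-(A * (l ^ 4 / p ^ 6))) ≤ EpTam p n) ∧
      (1 - p ≤ Real.exp (-(M * l)) → n * (1 - p) * Real.exp (-(A * l ^ 2)) ≤ EpTam p n) := by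
  obtain ⟨L, hL4, hL⟩ := exists_race_small
  refine ⟨512 * L, 512 * L * (L ^ 3 + 1) + 32, by linarith, by positivity, ?_⟩
  intro p hp0 hp1 n hn l hl hnl
  have hq : 0 < 1 - p := by linarith
  have hn0 : (0 : ℝ) < n := by exact_mod_cast (by omega : 0 < n)
  have hE := one_le_EpTam hp0 hp1.le (show 2 ≤ n by omega)
  obtain ⟨k, hk1, hk5, hk43, hk8⟩ := exists_stage_count hl
  have hl4 : l ≤ l ^ 4 / p ^ 6 ∧ l ^ 2 ≤ l ^ 4 / p ^ 6 := by
    have h1 : p ^ 6 ≤ 1 := pow_le_one₀ hp0.le hp1.le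
    have h2 : l ^ 4 ≤ l ^ 4 / p ^ 6 := by
      rw [le_div_iff₀ (by positivity)]
      exact mul_le_of_le_one_right (by positivity) h1
    exact ⟨(le_self_pow₀ hl (by norm_num)).trans h2,
      (pow_le_pow_right₀ hl (by norm_num)).trans h2⟩
  have hL3 : 0 ≤ L ^ 3 := by positivity
  by_cases hnq : 1 < n * (1 - p)
  swap
  · rw [not_lt] at hnq
    constructor
    · intro hM
      refine le_trans ?_ hE
      have h1 : n * Real.exp (-(512 * L * l)) ≤ 1 := le_trans (by gcongr) hnq
      refine le_trans (mul_le_mul_of_nonneg_left (Real.exp_le_exp.2 (neg_le_neg ?_)) hn0.le) h1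
      have h2 : 0 ≤ L ^ 4 * (l ^ 4 / p ^ 6) := by positivity
      have h3 := mul_le_mul_of_nonneg_left hl4.1 (show 0 ≤ 512 * L by linarith)
      linarith [hl4.1]
    · intro _
      refine le_trans (mul_le_one₀ hnq (Real.exp_pos _).le (Real.exp_le_one_iff.2 ?_)) hE
      rw [neg_nonpos]
      positivity
  obtain ⟨e, he1, he2, he3⟩ := exists_pow_near_inv hp0 hp1 (show 1 ≤ n by omega)
  rw [hnl] at he3
  have hrace := hL p hp0 hp1 l hl e k hk1 hk5 he3
  have hk1' : (1 : ℝ) ≤ k := by exact_mod_cast hk1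
  have h8k : 1 / (8 * (k : ℝ)) ≤ 1 / 8 := by
    rw [div_le_div_iff₀ (by positivity) (by norm_num)]
    linarith
  have he27 : Real.exp 1 ≤ 4 := by linarith [Real.exp_one_lt_d9]
  constructor
  · intro hM
    have hy4 : 4 ≤ L * l / p ^ 2 := by
      rw [le_div_iff₀ (by positivity)]
      have : p ^ 2 ≤ 1 := pow_le_one₀ hp0.le hp1.le
      nlinarith
    set y := L * l / p ^ 2 with hy
    have key := le_EpTam_of_scale hp0 hp1 (c := ⌊y ^ 3⌋₊) (by omega) hk1 (hnl ▸ hk43) he1 he2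
      (he27.trans hy4) le_rfl
      (fun ρ _ => ⟨Real.exp (y ^ 2)⁻¹, Real.one_le_exp (by positivity),
        (raceBound_exp_le hp0.le hp1.le (by linarith) e ρ).trans ((hrace y le_rfl).trans h8k)⟩)
      hrace
    refine le_trans ?_ key
    rw [mul_div_assoc]
    gcongr
    rw [le_div_iff₀ (by positivity)]
    calc _ ≤ Real.exp (-((512 * L * (L ^ 3 + 1) + 32) * (l ^ 4 / p ^ 6))) *
          Real.exp (32 * l ^ 2) := by gcongr
      _ = Real.exp (-((512 * L * (L ^ 3 + 1) + 32) * (l ^ 4 / p ^ 6)) + 32 * l ^ 2) :=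
          (Real.exp_add _ _).symm
      _ ≤ Real.exp (((1 + ⌊y ^ 3⌋₊ : ℕ) : ℝ) * -(512 * L * l)) := by
          refine Real.exp_le_exp.2 ?_
          have h1 : (⌊y ^ 3⌋₊ : ℝ) ≤ y ^ 3 := Nat.floor_le (by positivity)
          have h2 : l * y ^ 3 = L ^ 3 * (l ^ 4 / p ^ 6) := by rw [hy]; field_simp
          have h3 : l * ⌊y ^ 3⌋₊ ≤ L ^ 3 * (l ^ 4 / p ^ 6) := by rw [← h2]; gcongr
          have h4 := mul_le_mul_of_nonneg_left h3 (show 0 ≤ 512 * L by linarith)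
          have h5 := mul_le_mul_of_nonneg_left hl4.1 (show 0 ≤ 512 * L by linarith)
          push_cast
          linarith [hl4.2]
      _ = Real.exp (-(512 * L * l)) ^ (1 + ⌊y ^ 3⌋₊) := Real.exp_nat_mul _ _
      _ ≤ _ := by gcongr
  · intro hM
    have hMl : 0 ≤ 512 * L * l := by positivity
    have hp2 : 1 / 2 ≤ p := by
      have h1 : Real.exp (-(512 * L * l)) ≤ 1 / 2 := by
        rw [Real.exp_neg, inv_le_comm₀ (Real.exp_pos _) (by norm_num)]
        have := Real.add_one_le_exp (512 * L * l)
        nlinarith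
      linarith
    set y := Real.exp (-Real.log (1 - p) / 16) with hy
    have hy16 : (1 - p) * y ^ 16 = 1 := by
      rw [hy, ← Real.exp_nat_mul]
      nth_rw 1 [← Real.exp_log hq]
      rw [← Real.exp_add, ← Real.exp_zero]
      congr 1
      push_cast
      ring
    have hlog : 512 * L * l ≤ -Real.log (1 - p) := by
      have := (Real.log_le_iff_le_exp hq).2 hM
      linarith
    have hyM : Real.exp (32 * L * l) ≤ y := Real.exp_le_exp.2 (by linarith)
    have hy32 : 32 * L * l ≤ y := by linarith [Real.add_one_le_exp (32 * L * l)]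
    have hyL : L * l / p ^ 2 ≤ y := by
      refine le_trans ?_ hy32
      rw [div_le_iff₀ (by positivity)]
      have : 1 / 4 ≤ p ^ 2 := by nlinarith
      nlinarith [mul_nonneg (show 0 ≤ L by linarith) (show 0 ≤ l by linarith)]
    have hLl : 4 ≤ L * l := by nlinarith
    have hy1 : 1 ≤ y := by linarith
    have h72 : (72 : ℝ) * Real.exp l ≤ y ^ 4 := by
      have hy4 : Real.exp (l + 71) ≤ y ^ 4 := by
        refine le_trans (Real.exp_le_exp.2 ?_) (hyM.trans (le_self_pow₀ hy1 (by norm_num)))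
        linarith [mul_le_mul_of_nonneg_right hL4 (show 0 ≤ l by linarith)]
      rw [Real.exp_add] at hy4
      have h1 := mul_le_mul_of_nonneg_left (Real.add_one_le_exp (71 : ℝ)) (Real.exp_pos l).le
      linarith
    have he' : (e : ℝ) ≤ 2 * Real.exp l := by
      have := mul_le_mul_of_nonneg_right hp2 (Nat.cast_nonneg (α := ℝ) e)
      linarith
    have key := le_EpTam_of_scale hp0 hp1 (c := 0) (by omega) hk1 (hnl ▸ hk43) he1 he2
      (show Real.exp 1 ≤ y by linarith) (Nat.zero_le _)
      (fun ρ hρ => exists_raceBound_zero_le hp0.le hp1 hy1 hy16 (Real.one_le_exp (by linarith))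
        h72 he' hρ)
      (fun z hz => hrace z (hyL.trans hz))
    refine le_trans ?_ key
    rw [add_zero, pow_one, mul_div_assoc, mul_assoc]
    gcongr
    rw [le_div_iff₀ (by positivity), mul_assoc]
    refine mul_le_of_le_one_right hq.le ?_
    calc _ ≤ Real.exp (-((512 * L * (L ^ 3 + 1) + 32) * l ^ 2)) * Real.exp (32 * l ^ 2) := by
          gcongr
      _ = Real.exp (-((512 * L * (L ^ 3 + 1) + 32) * l ^ 2) + 32 * l ^ 2) :=
          (Real.exp_add _ _).symm
      _ ≤ 1 := by
          refine Real.exp_le_one_iff.2 ?_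
          have : 0 ≤ 512 * L * (L ^ 3 + 1) * l ^ 2 := by positivity
          linarith

/-! ### The probability of a unique maximum -/

/-- The weight of `x` under the geometric distribution with parameter `p`. -/
def geomWeight (p : ℝ) (x : ℕ) : ℝ := if 1 ≤ x then (1 - p) ^ (x - 1) * p else 0

theorem geomWeight_nonneg {p : ℝ} (hp0 : 0 ≤ p) (hp1 : p ≤ 1) (x : ℕ) : 0 ≤ geomWeight p x := by
  unfold geomWeight
  have : 0 ≤ 1 - p := by linarith
  split_ifs <;> positivity

theorem sum_range_geomWeight (p : ℝ) (N : ℕ) :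
    ∑ x ∈ Finset.range (N + 1), geomWeight p x = 1 - (1 - p) ^ N := by
  induction N with
  | zero => simp [geomWeight]
  | succ N ih =>
    rw [Finset.sum_range_succ, ih]
    simp [geomWeight]
    ring

theorem sum_piFinset_prod_le {n : ℕ} (s : Finset ℕ) (φ : Fin n → ℕ → ℝ) (b : Fin n → ℝ)
    (h0 : ∀ i x, 0 ≤ φ i x) (hb : ∀ i, ∑ x ∈ s, φ i x ≤ b i) :
    ∑ g ∈ Fintype.piFinset fun _ : Fin n => s, ∏ i, φ i (g i) ≤ ∏ i, b i := by
  rw [← Finset.prod_univ_sum]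
  exact Finset.prod_le_prod (fun i _ => Finset.sum_nonneg fun x _ => h0 i x) fun i _ => hb i

theorem exists_subset_piFinset_range {n : ℕ} (s : Finset (Fin n → ℕ)) (K : ℕ) :
    ∃ N, K ≤ N ∧ s ⊆ Fintype.piFinset fun _ : Fin n => Finset.range (N + 1) := by
  refine ⟨max K (s.sup fun g => Finset.univ.sup g), le_max_left _ _, fun g hg => ?_⟩
  rw [Fintype.mem_piFinset]
  intro i
  rw [Finset.mem_range, Nat.lt_succ_iff]
  exact ((Finset.le_sup (f := g) (Finset.mem_univ i)).trans
    (Finset.le_sup (f := fun g : Fin n → ℕ => Finset.univ.sup g) hg)).trans (le_max_right _ _)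

theorem zeta_eq (p : ℝ) (n : ℕ) : zeta p n = ∑' g : Fin n → ℕ,
    if ∃ i, ∀ j, j ≠ i → g j < g i then ∏ i, geomWeight p (g i) else 0 := rfl

theorem zeta_nonneg {p : ℝ} (hp0 : 0 ≤ p) (hp1 : p ≤ 1) (n : ℕ) : 0 ≤ zeta p n := by
  rw [zeta_eq]
  refine tsum_nonneg fun g => ?_
  split_ifs
  · exact Finset.prod_nonneg fun i _ => geomWeight_nonneg hp0 hp1 _
  · exact le_rfl

theorem zeta_le_of_pointwise {p : ℝ} {n : ℕ} {c : ℝ} (K : ℕ)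
    (F : (Fin n → ℕ) → ℝ) (hF0 : ∀ g, 0 ≤ F g)
    (hF : ∀ g, (∃ i, ∀ j, j ≠ i → g j < g i) → ∏ i, geomWeight p (g i) ≤ F g)
    (hc : ∀ N, K ≤ N → ∑ g ∈ Fintype.piFinset fun _ : Fin n => Finset.range (N + 1), F g ≤ c) :
    zeta p n ≤ c := by
  have hsum : ∀ s : Finset (Fin n → ℕ), ∑ g ∈ s, F g ≤ c := fun s => by
    obtain ⟨N, hN, hs⟩ := exists_subset_piFinset_range s K
    exact (Finset.sum_le_sum_of_subset_of_nonneg hs fun g _ _ => hF0 g).trans (hc N hN)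
  rw [zeta_eq]
  refine tsum_le_of_sum_le' (by simpa using hsum ∅) fun s => ?_
  refine (Finset.sum_le_sum fun g _ => ?_).trans (hsum s)
  split_ifs with h
  · exact hF g h
  · exact hF0 g

theorem sum_range_geomWeight_le_one {p : ℝ} (hp1 : p ≤ 1) (N : ℕ) :
    ∑ x ∈ Finset.range (N + 1), geomWeight p x ≤ 1 := by
  rw [sum_range_geomWeight]
  have : 0 ≤ (1 - p) ^ N := pow_nonneg (by linarith) _
  linarith

theorem zeta_le_one {p : ℝ} (hp0 : 0 ≤ p) (hp1 : p ≤ 1) (n : ℕ) : zeta p n ≤ 1 := by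
  refine zeta_le_of_pointwise 0 (fun g => ∏ i, geomWeight p (g i))
    (fun g => Finset.prod_nonneg fun i _ => geomWeight_nonneg hp0 hp1 _) (fun g _ => le_rfl) ?_
  intro N _
  have := sum_piFinset_prod_le (n := n) (Finset.range (N + 1)) (fun _ => geomWeight p) (fun _ => 1)
    (fun _ => geomWeight_nonneg hp0 hp1) (fun _ => sum_range_geomWeight_le_one hp1 N)
  simpa using this

theorem sum_range_geomWeight_le {p : ℝ} {J N : ℕ} (hN : J ≤ N) :
    ∑ x ∈ Finset.range (N + 1), geomWeight p x * (if x ≤ J then 1 else 0) = 1 - (1 - p) ^ J := by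
  simp_rw [mul_ite, mul_one, mul_zero]
  rw [← Finset.sum_filter, ← sum_range_geomWeight]
  refine Finset.sum_congr ?_ fun _ _ => rfl
  ext x
  simp only [Finset.mem_filter, Finset.mem_range]
  omega

theorem sum_range_geomWeight_ge {p : ℝ} (hp1 : p ≤ 1) {J N : ℕ} (hN : J ≤ N) :
    ∑ x ∈ Finset.range (N + 1), geomWeight p x * (if J < x then 1 else 0) ≤ (1 - p) ^ J := by
  have h : ∀ x, geomWeight p x * (if J < x then 1 else 0) =
      geomWeight p x - geomWeight p x * (if x ≤ J then 1 else 0) := fun x => by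
    by_cases hx : x ≤ J
    · simp [hx, not_lt.2 hx]
    · simp [hx, not_le.1 hx]
  simp_rw [h]
  rw [Finset.sum_sub_distrib, sum_range_geomWeight_le hN, sum_range_geomWeight]
  have : 0 ≤ (1 - p) ^ N := pow_nonneg (by linarith) _
  linarith

theorem sum_range_geomWeight_eq {p : ℝ} (hp1 : p ≤ 1) (J N : ℕ) :
    ∑ x ∈ Finset.range (N + 1), geomWeight p x * (if x = J + 1 then 1 else 0) ≤ (1 - p) ^ J := by
  have hq : 0 ≤ (1 - p) ^ J := pow_nonneg (by linarith) _
  simp_rw [mul_ite, mul_one, mul_zero]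
  rw [Finset.sum_ite_eq']
  split_ifs
  · simp only [geomWeight, Nat.le_add_left, if_true, Nat.add_sub_cancel]
    exact mul_le_of_le_one_right hq hp1
  · exact hq

theorem zeta_le {p : ℝ} (hp0 : 0 ≤ p) (hp1 : p ≤ 1) (n J : ℕ) :
    zeta p n ≤ n * (1 - p) ^ (J + 1) + (1 - (1 - p) ^ J) ^ n +
      n * ((1 - p) ^ J * (1 - (1 - p) ^ J) ^ (n - 1)) := by
  have hw := geomWeight_nonneg hp0 hp1
  have hq0 : 0 ≤ 1 - p := by linarith
  have hqJ : 0 ≤ (1 - p) ^ J := pow_nonneg hq0 _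
  let φ₁ : Fin n → Fin n → ℕ → ℝ := fun i j x =>
    geomWeight p x * (if j = i then (if J + 1 < x then 1 else 0) else 1)
  let φ₂ : Fin n → ℕ → ℝ := fun _ x => geomWeight p x * (if x ≤ J then 1 else 0)
  let φ₃ : Fin n → Fin n → ℕ → ℝ := fun i j x =>
    geomWeight p x * (if j = i then (if x = J + 1 then 1 else 0) else (if x ≤ J then 1 else 0))
  have h₁ : ∀ i j x, 0 ≤ φ₁ i j x := fun i j x =>
    mul_nonneg (hw x) (by split_ifs <;> norm_num)
  have h₂ : ∀ j x, 0 ≤ φ₂ j x := fun j x => mul_nonneg (hw x) (by split_ifs <;> norm_num)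
  have h₃ : ∀ i j x, 0 ≤ φ₃ i j x := fun i j x =>
    mul_nonneg (hw x) (by split_ifs <;> norm_num)
  have hP₁ : ∀ g : Fin n → ℕ, 0 ≤ ∑ i, ∏ j, φ₁ i j (g j) := fun g =>
    Finset.sum_nonneg fun i _ => Finset.prod_nonneg fun j _ => h₁ i j _
  have hP₂ : ∀ g : Fin n → ℕ, 0 ≤ ∏ j, φ₂ j (g j) := fun g =>
    Finset.prod_nonneg fun j _ => h₂ j _
  have hP₃ : ∀ g : Fin n → ℕ, 0 ≤ ∑ i, ∏ j, φ₃ i j (g j) := fun g =>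
    Finset.sum_nonneg fun i _ => Finset.prod_nonneg fun j _ => h₃ i j _
  refine zeta_le_of_pointwise (J + 1) (fun g => ∑ i, ∏ j, φ₁ i j (g j) + ∏ j, φ₂ j (g j) +
    ∑ i, ∏ j, φ₃ i j (g j)) (fun g => add_nonneg (add_nonneg (hP₁ g) (hP₂ g)) (hP₃ g)) ?_ ?_
  · rintro g ⟨i, hi⟩
    rcases lt_trichotomy (g i) (J + 1) with h | h | h
    · have : ∏ j, geomWeight p (g j) = ∏ j, φ₂ j (g j) := Finset.prod_congr rfl fun j _ => by
        have : g j ≤ J := by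
          by_cases hj : j = i
          · subst hj; omega
          · have := hi j hj; omega
        simp [φ₂, this]
      linarith [hP₁ g, hP₃ g]
    · have : ∏ j, geomWeight p (g j) = ∏ j, φ₃ i j (g j) := Finset.prod_congr rfl fun j _ => by
        by_cases hj : j = i
        · subst hj; simp [φ₃, h]
        · have : g j ≤ J := by have := hi j hj; omega
          simp [φ₃, this, hj]
      have h' := Finset.single_le_sum (f := fun i => ∏ j, φ₃ i j (g j))
        (fun i _ => Finset.prod_nonneg fun j _ => h₃ i j _) (Finset.mem_univ i)
      linarith [hP₁ g, hP₂ g]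
    · have : ∏ j, geomWeight p (g j) = ∏ j, φ₁ i j (g j) := Finset.prod_congr rfl fun j _ => by
        by_cases hj : j = i
        · subst hj; simp [φ₁, h]
        · simp [φ₁, hj]
      have h' := Finset.single_le_sum (f := fun i => ∏ j, φ₁ i j (g j))
        (fun i _ => Finset.prod_nonneg fun j _ => h₁ i j _) (Finset.mem_univ i)
      linarith [hP₂ g, hP₃ g]
  · intro N hN
    have hS₁ : ∀ i : Fin n, ∑ g ∈ Fintype.piFinset fun _ : Fin n => Finset.range (N + 1),
        ∏ j, φ₁ i j (g j) ≤ (1 - p) ^ (J + 1) := fun i => by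
      refine (sum_piFinset_prod_le _ (φ₁ i) (fun j => if j = i then (1 - p) ^ (J + 1) else 1)
        (h₁ i) fun j => ?_).trans (le_of_eq (by simp))
      by_cases hj : j = i
      · simp only [φ₁, hj, if_true]
        exact sum_range_geomWeight_ge hp1 hN
      · simp only [φ₁, hj, if_false, mul_one]
        exact sum_range_geomWeight_le_one hp1 N
    have hS₂ : ∑ g ∈ Fintype.piFinset fun _ : Fin n => Finset.range (N + 1),
        ∏ j, φ₂ j (g j) ≤ (1 - (1 - p) ^ J) ^ n :=
      (sum_piFinset_prod_le _ φ₂ (fun _ => 1 - (1 - p) ^ J) h₂ fun j =>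
        (sum_range_geomWeight_le (by omega)).le).trans (le_of_eq (by simp))
    have hS₃ : ∀ i : Fin n, ∑ g ∈ Fintype.piFinset fun _ : Fin n => Finset.range (N + 1),
        ∏ j, φ₃ i j (g j) ≤ (1 - p) ^ J * (1 - (1 - p) ^ J) ^ (n - 1) := fun i => by
      refine (sum_piFinset_prod_le _ (φ₃ i)
        (fun j => if j = i then (1 - p) ^ J else 1 - (1 - p) ^ J) (h₃ i) fun j => ?_).trans
        (le_of_eq ?_)
      · by_cases hj : j = i
        · simp only [φ₃, hj, if_true]
          exact sum_range_geomWeight_eq hp1 J N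
        · simp only [φ₃, hj, if_false]
          exact (sum_range_geomWeight_le (by omega)).le
      · rw [← Finset.mul_prod_erase _ _ (Finset.mem_univ i), if_pos rfl]
        congr 1
        rw [Finset.prod_congr rfl fun j hj => if_neg (Finset.ne_of_mem_erase hj)]
        simp
    rw [Finset.sum_add_distrib, Finset.sum_add_distrib, Finset.sum_comm,
      Finset.sum_comm (s := Fintype.piFinset _) (t := Finset.univ)]
    have e₁ := Finset.sum_le_card_nsmul Finset.univ _ _ fun i _ => hS₁ i
    have e₃ := Finset.sum_le_card_nsmul Finset.univ _ _ fun i _ => hS₃ i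
    rw [Finset.card_univ, Fintype.card_fin, nsmul_eq_mul] at e₁ e₃
    linarith

theorem zetaMinus_le_of_frequently {p c : ℝ} (hp0 : 0 ≤ p) (hp1 : p ≤ 1)
    (h : ∃ᶠ n in Filter.atTop, zeta p n ≤ c) : zetaMinus p ≤ c :=
  Filter.liminf_le_of_frequently_le h
    (Filter.isBoundedUnder_of ⟨0, fun n => zeta_nonneg hp0 hp1 n⟩)

theorem zetaMinus_le_one {p : ℝ} (hp0 : 0 ≤ p) (hp1 : p ≤ 1) : zetaMinus p ≤ 1 :=
  zetaMinus_le_of_frequently hp0 hp1 (Filter.Frequently.of_forall fun n => zeta_le_one hp0 hp1 n)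

theorem zetaMinus_le {p : ℝ} (hp0 : 0 < p) (hp1 : p < 1) :
    zetaMinus p ≤ (1 - p) * (5 - 2 * Real.log (1 - p)) := by
  have hq : 0 < 1 - p := by linarith
  refine zetaMinus_le_of_frequently hp0.le hp1.le (Filter.frequently_atTop.2 fun a => ?_)
  set t := -Real.log (1 - p) with ht
  have ht0 : 0 < t := neg_pos.2 (Real.log_neg hq (by linarith))
  obtain ⟨J, hJ⟩ := exists_pow_lt_of_lt_one (show 0 < t / (a + 1) by positivity)
    (show 1 - p < 1 by linarith)
  set y := (1 - p) ^ J with hy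
  have hy0 : 0 < y := pow_pos hq _
  have hy1 : y ≤ 1 := pow_le_one₀ hq.le (by linarith)
  have hm1 : t / y ≤ ⌈t / y⌉₊ := Nat.le_ceil _
  have hm2 : (⌈t / y⌉₊ : ℝ) < t / y + 1 := Nat.ceil_lt_add_one (by positivity)
  set m := ⌈t / y⌉₊
  have hty : t ≤ m * y := (div_le_iff₀ hy0).1 hm1
  have hmy : m * y ≤ t + y := by
    have := mul_le_mul_of_nonneg_right hm2.le hy0.le
    rwa [add_mul, div_mul_cancel₀ _ hy0.ne', one_mul] at this
  refine ⟨m + 1, ?_, (zeta_le hp0.le hp1.le (m + 1) J).trans ?_⟩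
  · rw [lt_div_iff₀ (by positivity)] at hJ
    have h1 : (a : ℝ) + 1 ≤ m := by
      refine le_trans ?_ hm1
      rw [le_div_iff₀ hy0]
      linarith
    have : a + 1 ≤ m := by exact_mod_cast h1
    omega
  · have hexp : (1 - y) ^ m ≤ 1 - p := by
      calc (1 - y) ^ m ≤ Real.exp (-y) ^ m :=
            pow_le_pow_left₀ (by linarith) (Real.one_sub_le_exp_neg y) _
        _ = Real.exp (m * -y) := (Real.exp_nat_mul _ _).symm
        _ ≤ Real.exp (Real.log (1 - p)) := Real.exp_le_exp.2 (by linarith)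
        _ = 1 - p := Real.exp_log hq
    have h0 : 0 ≤ (1 - y) ^ m := pow_nonneg (by linarith) _
    have h1 : (1 - y) ^ (m + 1) ≤ 1 - p := by
      rw [pow_succ]
      exact (mul_le_of_le_one_right h0 (by linarith)).trans hexp
    have h2 : ((m : ℝ) + 1) * y ≤ t + 2 := by linarith
    rw [← hy, Nat.add_sub_cancel, pow_succ, ← hy]
    push_cast
    have h3 : ((m : ℝ) + 1) * y * (1 - p) ≤ (t + 2) * (1 - p) := by gcongr
    have h4 : ((m : ℝ) + 1) * y * (1 - y) ^ m ≤ (t + 2) * (1 - p) := by gcongr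
    have h5 : (1 - p) * (5 - 2 * Real.log (1 - p)) =
      (t + 2) * (1 - p) + (1 - p) + (t + 2) * (1 - p) := by rw [ht]; ring
    rw [h5]
    linarith

/-! ### The main estimate -/

theorem one_le_log_log {n : ℕ} (hn : 16 ≤ n) : 1 ≤ Real.log (Real.log n) := by
  have hlogn : Real.exp 1 ≤ Real.log n := by
    have h1 : Real.log 16 ≤ Real.log n := Real.log_le_log (by norm_num) (by exact_mod_cast hn)
    have h2 : Real.log 16 = 4 * Real.log 2 := by
      rw [show (16 : ℝ) = 2 ^ 4 by norm_num, Real.log_pow]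
      norm_num
    linarith [Real.log_two_gt_d9, Real.exp_one_lt_d9]
  rwa [Real.le_log_iff_exp_le ((Real.exp_pos 1).trans_le hlogn)]

theorem div_pow_six_le {p D : ℝ} (hp0 : 0 < p) (hD : 1 ≤ D) :
    D / p ^ 6 ≤ p ^ 8 * Real.exp (5040 * D / p ^ 2) := by
  have h := Real.pow_div_factorial_le_exp (5040 * D / p ^ 2) (by positivity) 7
  have h7 : ((Nat.factorial 7 : ℕ) : ℝ) = 5040 := by norm_num [Nat.factorial]
  rw [h7] at h
  calc D / p ^ 6 ≤ D ^ 7 / p ^ 6 := by gcongr; exact le_self_pow₀ hD (by norm_num)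
    _ ≤ 5040 ^ 6 * (D ^ 7 / p ^ 6) := le_mul_of_one_le_left (by positivity) (by norm_num)
    _ = p ^ 8 * ((5040 * D / p ^ 2) ^ 7 / 5040) := by field_simp
    _ ≤ _ := by gcongr

theorem thm2 :
    ∃ C : ℝ, 0 < C ∧ ∀ p : ℝ, 0 < p → p < 1 → ∀ n : ℕ, 16 ≤ n →
      zetaMinus p * n *
          Real.exp (-(p ^ 8) * Real.exp (C / p ^ 2) * (Real.log (Real.log n)) ^ 4) ≤
        EpTam p n := by
  obtain ⟨M, A, -, hA, hE⟩ := exists_le_EpTam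
  refine ⟨5040 * (A + 4), by positivity, ?_⟩
  intro p hp0 hp1 n hn
  have hq : 0 < 1 - p := by linarith
  have hn0 : (0 : ℝ) < n := by exact_mod_cast (by omega : 0 < n)
  have hlogn : 0 < Real.log n := Real.log_pos (by exact_mod_cast (by omega : 1 < n))
  have hl : 1 ≤ Real.log (Real.log n) := one_le_log_log hn
  have hnl : Real.log n = Real.exp (Real.log (Real.log n)) := (Real.exp_log hlogn).symm
  set l := Real.log (Real.log n)
  obtain ⟨h₁, h₂⟩ := hE p hp0 hp1 n hn l hl hnl
  have hD := div_pow_six_le hp0 (show 1 ≤ A + 4 by linarith)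
  set D := (A + 4) / p ^ 6 with hD_def
  have hexp : Real.exp (-(p ^ 8) * Real.exp (5040 * (A + 4) / p ^ 2) * l ^ 4) ≤
      Real.exp (-(D * l ^ 4)) := by
    refine Real.exp_le_exp.2 ?_
    have := mul_le_mul_of_nonneg_right hD (show 0 ≤ l ^ 4 by positivity)
    linarith
  have hDA : A + 4 ≤ D := by
    rw [hD_def, le_div_iff₀ (by positivity)]
    exact mul_le_of_le_one_right (by linarith) (pow_le_one₀ hp0.le hp1.le)
  have hl24 : l ^ 2 ≤ l ^ 4 := pow_le_pow_right₀ hl (by norm_num)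
  have hl2 : l ≤ l ^ 2 := le_self_pow₀ hl (by norm_num)
  have hDl : A * l ^ 2 + 4 * l ≤ D * l ^ 4 := by
    have h3 : (A + 4) * l ^ 2 ≤ D * l ^ 4 := by gcongr
    linarith
  rcases le_total (Real.exp (-(M * l))) (1 - p) with hM | hM
  · calc _ ≤ 1 * n * Real.exp (-(D * l ^ 4)) := by
          gcongr
          exact zetaMinus_le_one hp0.le hp1.le
      _ ≤ n * Real.exp (-(A * (l ^ 4 / p ^ 6))) := by
          have h3 : A * (l ^ 4 / p ^ 6) ≤ D * l ^ 4 := by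
            calc A * (l ^ 4 / p ^ 6) ≤ (A + 4) * (l ^ 4 / p ^ 6) := by gcongr; linarith
              _ = D * l ^ 4 := by rw [hD_def]; ring
          rw [one_mul]
          gcongr
      _ ≤ _ := h₁ hM
  have hz := zetaMinus_le hp0 hp1
  set t := -Real.log (1 - p) with ht
  have he27 : (2.7 : ℝ) ≤ Real.exp 1 := by linarith [Real.exp_one_gt_d9]
  have h9 : 9 * Real.exp l ≤ Real.exp (4 * l) := by
    have h3 : (9 : ℝ) ≤ Real.exp (3 * l) := by
      calc (9 : ℝ) ≤ 2.7 ^ 3 := by norm_num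
        _ ≤ Real.exp 1 ^ 3 := by gcongr
        _ = Real.exp 3 := by rw [← Real.exp_nat_mul]; norm_num
        _ ≤ _ := Real.exp_le_exp.2 (by linarith)
    calc 9 * Real.exp l ≤ Real.exp (3 * l) * Real.exp l := by gcongr
      _ = Real.exp (4 * l) := by rw [← Real.exp_add]; congr 1; ring
  have hel : 1 ≤ Real.exp l := Real.one_le_exp (by linarith)
  have hL : zetaMinus p * n *
      Real.exp (-(p ^ 8) * Real.exp (5040 * (A + 4) / p ^ 2) * l ^ 4) ≤
      n * (1 - p) * (5 + 2 * t) * (Real.exp (-(A * l ^ 2)) * Real.exp (-(4 * l))) := by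
    have ht0 : 0 ≤ t := by
      rw [ht, neg_nonneg]
      exact Real.log_nonpos hq.le (by linarith)
    calc _ ≤ (1 - p) * (5 - 2 * Real.log (1 - p)) * n * Real.exp (-(D * l ^ 4)) := by
          gcongr
          exact mul_nonneg (mul_nonneg hq.le (by linarith)) (Nat.cast_nonneg n)
      _ = n * (1 - p) * (5 + 2 * t) * Real.exp (-(D * l ^ 4)) := by rw [ht]; ring
      _ ≤ _ := by
          rw [← Real.exp_add]
          gcongr
          linarith
  refine hL.trans ?_
  have h4 : Real.exp (4 * l) * Real.exp (-(4 * l)) = 1 := by rw [← Real.exp_add]; simp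
  have hlogmul : Real.log (n * (1 - p)) = Real.exp l - t := by
    rw [Real.log_mul hn0.ne' hq.ne', hnl, ht]; ring
  rcases le_total 1 (n * (1 - p)) with hnq | hnq
  · have h5 : t ≤ Real.exp l := by linarith [Real.log_nonneg hnq]
    have h6 : (5 + 2 * t) * Real.exp (-(4 * l)) ≤ 1 := by
      rw [← h4]
      gcongr
      linarith
    calc _ = n * (1 - p) * Real.exp (-(A * l ^ 2)) * ((5 + 2 * t) * Real.exp (-(4 * l))) := by
          ring
      _ ≤ n * (1 - p) * Real.exp (-(A * l ^ 2)) * 1 := by gcongr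
      _ ≤ _ := by rw [mul_one]; exact h₂ hM
  · refine le_trans ?_ (one_le_EpTam hp0 hp1.le (show 2 ≤ n by omega))
    have hx0 : 0 < n * (1 - p) := by positivity
    have h5 := Real.one_sub_inv_le_log_of_pos hx0
    have h6 : n * (1 - p) * (1 - (n * (1 - p))⁻¹) ≤ n * (1 - p) * (Real.exp l - t) := by
      rw [← hlogmul]; gcongr
    rw [mul_sub, mul_one, mul_inv_cancel₀ hx0.ne'] at h6
    have h7 : n * (1 - p) * Real.exp l ≤ 1 * Real.exp l := by gcongr
    have h8 : n * (1 - p) * (5 + 2 * t) ≤ Real.exp (4 * l) := by linarith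
    have h10 : Real.exp (-(A * l ^ 2)) ≤ 1 := by
      rw [Real.exp_le_one_iff, neg_nonpos]; positivity
    calc _ ≤ Real.exp (4 * l) * (1 * Real.exp (-(4 * l))) := by gcongr
      _ = 1 := by rw [one_mul, h4]
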